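/- arXiv:1612.05099 — 9 statements merged into one kernel-verified Lean document; each statement's English description precedes it below -/
import Mathlib

section
/- Let n ≥ 1 and let H_0,…,H_{2n−1} be finite-dimensional complex Hilbert spaces. A positive semidefinite operator R on H_0⊗H_1⊗⋯⊗H_{2n−1} belongs to Comb_n(H_0,…,H_{2n−1}) if and only if there exist positive semidefinite operators R^{(j)} on H_0⊗H_1⊗⋯⊗H_{2j+1} for j = 0,…,n−1 such that R^{(n−1)} = R, Tr_{H_{2j+1}}[R^{(j)}] = R^{(j−1)}⊗I_{H_{2j}} for every 1 ≤ j ≤ n−1, and Tr_{H_1}[R^{(0)}] = I_{H_0}. -/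
open Matrix Kronecker ComplexOrder

noncomputable section

private theorem cast_pi {G : ℕ → Type} {q : ℕ} (f : ∀ j : Fin q, G j) {a b : ℕ}
    (h : a = b) (ha : a < q) (hb : b < q) :
    cast (congrArg G h) (f ⟨a, ha⟩) = f ⟨b, hb⟩ := by subst h; rfl

/-- Reinterpreting a tensor product along an equality of the number of factors. -/
def piFinCast (H : ℕ → Type) {q q' : ℕ} (h : q = q') :
    (∀ j : Fin q, H j) ≃ (∀ j : Fin q', H j) where
  toFun f j := f ⟨j, h ▸ j.isLt⟩
  invFun f j := f ⟨j, h ▸ j.isLt⟩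
  left_inv f := rfl
  right_inv f := rfl

/-- The canonical identification of `H_0 ⊗ H_1 ⊗ ⋯ ⊗ H_{k+1}` with
`H_0 ⊗ (H_1 ⊗ ⋯ ⊗ H_k) ⊗ H_{k+1}`. -/
def splitEnds (H : ℕ → Type) (k : ℕ) :
    (∀ j : Fin (k + 2), H j) ≃ (H 0 × (∀ j : Fin k, H (j + 1)) × H (k + 1)) where
  toFun f := (f ⟨0, by omega⟩, fun j => f ⟨(j : ℕ) + 1, by omega⟩, f ⟨k + 1, by omega⟩)
  invFun x j :=
    if h0 : (j : ℕ) = 0 then cast (congrArg H h0.symm) x.1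
    else if hk : (j : ℕ) = k + 1 then cast (congrArg H hk.symm) x.2.2
    else cast (congrArg H (by omega : (j : ℕ) - 1 + 1 = (j : ℕ)))
      (x.2.1 ⟨(j : ℕ) - 1, by omega⟩)
  left_inv f := by
    funext j
    dsimp only
    split_ifs with h0 hk
    · exact cast_pi f h0.symm (by omega) (by omega)
    · exact cast_pi f hk.symm (by omega) (by omega)
    · exact cast_pi f (by omega) (by omega) (by omega)
  right_inv x := by
    obtain ⟨a, g, b⟩ := x
    refine Prod.ext ?_ (Prod.ext ?_ ?_)
    · rfl
    · funext j
      dsimp only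
      rw [dif_neg (by omega), dif_neg (by have := j.isLt; omega)]
      exact cast_eq _ (g j)
    · dsimp only
      rw [dif_neg (by omega), dif_pos rfl]
      exact cast_eq _ b


/-- Partial trace over the middle tensor factor. -/
def ptrMid {α β γ : Type*} [Fintype β] (M : Matrix (α × β × γ) (α × β × γ) ℂ) :
    Matrix (α × γ) (α × γ) ℂ :=
  fun p q => ∑ b, M (p.1, b, p.2) (q.1, b, q.2)

/-- Partial trace over the last of `k+1` tensor factors. -/
def trLast {H : ℕ → Type} [∀ j, Fintype (H j)] (k : ℕ)
    (R : Matrix (∀ j : Fin (k + 1), H j) (∀ j : Fin (k + 1), H j) ℂ) :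
    Matrix (∀ j : Fin k, H j) (∀ j : Fin k, H j) ℂ :=
  fun u v => ∑ b : H k, R (Fin.snoc u b) (Fin.snoc v b)

/-- The set of deterministic 1-combs on a pair of factors `α ⊗ β`: positive semidefinite
operators whose partial trace over `β` is the identity on `α`. -/
def comb1Set (α β : Type*) [Fintype α] [DecidableEq α] [Fintype β] :
    Set (Matrix (α × β) (α × β) ℂ) :=
  {M | M.PosSemidef ∧ (fun a a' => ∑ b, M (a, b) (a', b)) = (1 : Matrix α α ℂ)}

/-- The set `Comb_n(H_0,…,H_{2n−1})` of deterministic `n`-combs, defined recursively: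
a `1`-comb is a PSD operator `R` on `H_0⊗H_1` with `Tr_{H_1}[R] = I_{H_0}`; an `n`-comb
(`n ≥ 2`) is a PSD operator `R` on `H_0⊗⋯⊗H_{2n−1}` such that for every `(n−1)`-comb `S` on
`H_1⊗⋯⊗H_{2n−2}` the operator `Tr_{H_1⊗⋯⊗H_{2n−2}}[(I_{H_0}⊗S⊗I_{H_{2n−1}})·R]` is a
`1`-comb on `H_0⊗H_{2n−1}`.  (The value at `n = 0` is irrelevant and set to `∅`.) -/
def Comb : (n : ℕ) → (H : ℕ → Type) → [∀ j, Fintype (H j)] → [∀ j, DecidableEq (H j)] →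
    Set (Matrix (∀ j : Fin (2 * n), H j) (∀ j : Fin (2 * n), H j) ℂ)
  | 0, _, _, _ => ∅
  | 1, H, _, _ => {R | R.PosSemidef ∧ trLast 1 R = (1 : Matrix (∀ j : Fin 1, H j) (∀ j : Fin 1, H j) ℂ)}
  | (n + 2), H, _, _ =>
    {R | R.PosSemidef ∧ ∀ S ∈ Comb (n + 1) (fun m => H (m + 1)),
      ptrMid (((1 : Matrix (H 0) (H 0) ℂ) ⊗ₖ
          (S ⊗ₖ (1 : Matrix (H (2 * (n + 1) + 1)) (H (2 * (n + 1) + 1)) ℂ))) *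
        (Matrix.reindex (splitEnds H (2 * (n + 1))) (splitEnds H (2 * (n + 1))) R)) ∈
      comb1Set (H 0) (H (2 * (n + 1) + 1))}


/-- `M ⊗ I`: tensoring an operator on `H_0⊗⋯⊗H_{k−1}` with the identity on a last factor
`H_k`. -/
def tensorIdLast {H : ℕ → Type} [∀ j, Fintype (H j)] [∀ j, DecidableEq (H j)] (k : ℕ)
    (M : Matrix (∀ j : Fin k, H j) (∀ j : Fin k, H j) ℂ) :
    Matrix (∀ j : Fin (k + 1), H j) (∀ j : Fin (k + 1), H j) ℂ :=
  fun u v => M (Fin.init u) (Fin.init v) *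
    (if u (Fin.last k) = v (Fin.last k) then 1 else 0)


def pairC {H : ℕ → Type} [∀ j, Fintype (H j)] (k : ℕ)
    (S : Matrix (∀ j : Fin k, H (j + 1)) (∀ j : Fin k, H (j + 1)) ℂ)
    (T : Matrix (∀ j : Fin (k + 1), H j) (∀ j : Fin (k + 1), H j) ℂ) :
    Matrix (H 0) (H 0) ℂ :=
  fun a a' => ∑ s, ∑ s', S s s' * T (Fin.cons (α := fun j : Fin (k + 1) => H j) a s')
    (Fin.cons (α := fun j : Fin (k + 1) => H j) a' s)

theorem sum_snocC {H : ℕ → Type} [∀ j, Fintype (H j)] (k : ℕ)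
    (f : (∀ j : Fin (k + 1), H j) → ℂ) :
    ∑ x, f x = ∑ u : (∀ j : Fin k, H j), ∑ b : H k,
      f (Fin.snoc (α := fun j : Fin (k + 1) => H j) u b) := by
  rw [Finset.sum_comm]
  rw [← (Fin.snocEquiv (fun j : Fin (k + 1) => H j)).sum_comp, Fintype.sum_prod_type]
  rfl

theorem cons_snocC {H : ℕ → Type} (k : ℕ) (a : H 0) (s : ∀ j : Fin k, H (j + 1)) (b : H (k + 1)) :
    Fin.cons (α := fun j : Fin (k + 1 + 1) => H j) a
      (Fin.snoc (α := fun j : Fin (k + 1) => H (j + 1)) s b) =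
    Fin.snoc (α := fun j : Fin (k + 1 + 1) => H j)
      (Fin.cons (α := fun j : Fin (k + 1) => H j) a s) b := by
  funext i
  cases i using Fin.cases with
  | zero => 
    exact (Fin.snoc_castSucc (α := fun j : Fin (k + 1 + 1) => H j) b
      (Fin.cons (α := fun j : Fin (k + 1) => H j) a s) 0).symm
  | succ j =>
    cases j using Fin.lastCases with
    | last => 
      exact (Fin.snoc_last (α := fun j : Fin (k + 1) => H (j + 1)) b s).trans
        (Fin.snoc_last (α := fun j : Fin (k + 1 + 1) => H j) b
          (Fin.cons (α := fun j : Fin (k + 1) => H j) a s)).symm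
    | cast j =>
      exact (Fin.snoc_castSucc (α := fun j : Fin (k + 1) => H (j + 1)) b s j).trans
        (Fin.snoc_castSucc (α := fun j : Fin (k + 1 + 1) => H j) b
          (Fin.cons (α := fun j : Fin (k + 1) => H j) a s) j.succ).symm

theorem tensor_snocC {H : ℕ → Type} [∀ j, Fintype (H j)] [∀ j, DecidableEq (H j)] (k : ℕ)
    (M : Matrix (∀ j : Fin k, H j) (∀ j : Fin k, H j) ℂ) (u v : ∀ j : Fin k, H j) (b c : H k) :
    tensorIdLast k M (Fin.snoc (α := fun j : Fin (k + 1) => H j) u b)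
      (Fin.snoc (α := fun j : Fin (k + 1) => H j) v c) = M u v * (if b = c then 1 else 0) := by
  unfold tensorIdLast
  rw [Fin.init_snoc, Fin.init_snoc, Fin.snoc_last, Fin.snoc_last]

theorem pairC_tensor_right {H : ℕ → Type} [∀ j, Fintype (H j)] [∀ j, DecidableEq (H j)] (k : ℕ)
    (S : Matrix (∀ j : Fin (k + 1), H (j + 1)) (∀ j : Fin (k + 1), H (j + 1)) ℂ)
    (T : Matrix (∀ j : Fin (k + 1), H j) (∀ j : Fin (k + 1), H j) ℂ) :
    pairC (k + 1) S (tensorIdLast (k + 1) T) =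
      pairC k (trLast (H := fun m => H (m + 1)) k S) T := by
  ext a a'
  unfold pairC trLast
  rw [sum_snocC (H := fun m => H (m + 1))]
  refine Finset.sum_congr rfl fun s _ => ?_
  simp_rw [sum_snocC (H := fun m => H (m + 1)) k, cons_snocC, tensor_snocC]
  rw [Finset.sum_comm]
  refine Finset.sum_congr rfl fun s' _ => ?_
  rw [Finset.sum_mul]
  simp

theorem pairC_tensor_left {H : ℕ → Type} [∀ j, Fintype (H j)] [∀ j, DecidableEq (H j)] (k : ℕ)
    (S : Matrix (∀ j : Fin k, H (j + 1)) (∀ j : Fin k, H (j + 1)) ℂ)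
    (T : Matrix (∀ j : Fin (k + 1 + 1), H j) (∀ j : Fin (k + 1 + 1), H j) ℂ) :
    pairC (k + 1) (tensorIdLast (H := fun m => H (m + 1)) k S) T =
      pairC k S (trLast (k + 1) T) := by
  ext a a'
  unfold pairC trLast
  rw [sum_snocC (H := fun m => H (m + 1))]
  refine Finset.sum_congr rfl fun s _ => ?_
  simp_rw [sum_snocC (H := fun m => H (m + 1)) k, cons_snocC, 
    tensor_snocC (H := fun m => H (m + 1))]
  rw [Finset.sum_comm]
  refine Finset.sum_congr rfl fun s' _ => ?_
  rw [Finset.mul_sum]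
  simp

theorem pairC_zero {H : ℕ → Type} [∀ j, Fintype (H j)] [∀ j, DecidableEq (H j)] 
    (T : Matrix (∀ j : Fin (0 + 1), H j) (∀ j : Fin (0 + 1), H j) ℂ) :
    pairC 0 1 T = 1 ↔ T = 1 := by
  have key : ∀ a a', pairC 0 1 T a a' = T (Fin.cons (α := fun j : Fin (0 + 1) => H j) a (fun j => j.elim0)) (Fin.cons (α := fun j : Fin (0 + 1) => H j) a' (fun j => j.elim0)) := by
    intro a a'
    unfold pairC
    rw [Fintype.sum_subsingleton _ (fun j => j.elim0), Fintype.sum_subsingleton _ (fun j => j.elim0)]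
    simp
  have hc : ∀ u : (∀ j : Fin (0 + 1), H j), u = Fin.cons (α := fun j : Fin (0 + 1) => H j) (u 0) (fun j => j.elim0) := by
    intro u; ext j; obtain rfl : j = 0 := Subsingleton.elim (α := Fin 1) j 0
    rfl
  have hi : ∀ u v : (∀ j : Fin (0 + 1), H j), u = v ↔ u 0 = v 0 := by
    intro u v
    refine ⟨fun h => h ▸ rfl, fun h => ?_⟩
    rw [hc u, hc v, h]
  constructor
  · intro h
    ext u v
    have := congrFun (congrFun h (u 0)) (v 0)
    rw [key, ← hc, ← hc] at this
    rw [this, Matrix.one_apply, Matrix.one_apply]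
    simp [hi]
  · intro h
    ext a a'
    rw [key, h, Matrix.one_apply, Matrix.one_apply]
    simp [hi]

theorem tensor_oneC {H : ℕ → Type} [∀ j, Fintype (H j)] [∀ j, DecidableEq (H j)] (k : ℕ) :
    tensorIdLast (H := H) k 1 = 1 := by
  ext u v
  rw [← Fin.snoc_init_self u, ← Fin.snoc_init_self v]
  erw [tensor_snocC]
  simp only [Matrix.one_apply, Fin.snoc_inj]
  split_ifs <;> simp_all

theorem trLast_tensorC {H : ℕ → Type} [∀ j, Fintype (H j)] [∀ j, DecidableEq (H j)] (k : ℕ)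
    (M : Matrix (∀ j : Fin k, H j) (∀ j : Fin k, H j) ℂ) :
    trLast k (tensorIdLast k M) = (Fintype.card (H k) : ℂ) • M := by
  ext u v
  unfold trLast
  simp_rw [tensor_snocC]
  simp

theorem psd_tensorC {H : ℕ → Type} [∀ j, Fintype (H j)] [∀ j, DecidableEq (H j)] (k : ℕ)
    (M : Matrix (∀ j : Fin k, H j) (∀ j : Fin k, H j) ℂ) (hM : M.PosSemidef) :
    (tensorIdLast k M).PosSemidef := by
  have h := (hM.kronecker (Matrix.PosSemidef.one (n := H k) (R := ℂ))).submatrix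
    (fun u : (∀ j : Fin (k + 1), H j) => ((fun j : Fin k => u j.castSucc), u (Fin.last k)))
  have e : tensorIdLast k M = (M ⊗ₖ (1 : Matrix (H k) (H k) ℂ)).submatrix
    (fun u : (∀ j : Fin (k + 1), H j) => ((fun j : Fin k => u j.castSucc), u (Fin.last k)))
    (fun u : (∀ j : Fin (k + 1), H j) => ((fun j : Fin k => u j.castSucc), u (Fin.last k))) := by
    ext u v
    rw [Matrix.submatrix_apply, Matrix.kroneckerMap_apply, Matrix.one_apply]
    rfl
  rw [e]
  exact h

theorem psd_trLastC {H : ℕ → Type} [∀ j, Fintype (H j)] (k : ℕ)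
    (M : Matrix (∀ j : Fin (k + 1), H j) (∀ j : Fin (k + 1), H j) ℂ) (hM : M.PosSemidef) :
    (trLast k M).PosSemidef := by
  have : trLast k M = ∑ b : H k, M.submatrix (fun u => Fin.snoc (α := fun j : Fin (k + 1) => H j) u b) (fun u => Fin.snoc (α := fun j : Fin (k + 1) => H j) u b) := by
    ext u v
    rw [Matrix.sum_apply]; rfl
  rw [this]
  exact Matrix.posSemidef_sum _ fun b _ => hM.submatrix _

theorem ptrMid_cycC {α β γ : Type*} [Fintype α] [Fintype β] [Fintype γ] [DecidableEq α]
    [DecidableEq γ] (A : Matrix β β ℂ) (M : Matrix (α × β × γ) (α × β × γ) ℂ) :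
    ptrMid (((1 : Matrix α α ℂ) ⊗ₖ (A ⊗ₖ (1 : Matrix γ γ ℂ))) * M) =
    ptrMid (M * ((1 : Matrix α α ℂ) ⊗ₖ (A ⊗ₖ (1 : Matrix γ γ ℂ)))) := by
  ext p q
  unfold ptrMid
  simp only [Matrix.mul_apply, Fintype.sum_prod_type, Matrix.kroneckerMap_apply, Matrix.one_apply]
  simp only [ite_mul, mul_ite, one_mul, zero_mul, mul_one, mul_zero, Finset.sum_ite_eq, Finset.sum_ite_eq', Finset.sum_const_zero, Finset.mem_univ, if_true, Finset.sum_ite_irrel]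
  rw [Finset.sum_comm]
  simp [mul_comm]

open scoped MatrixOrder Matrix.Norms.L2Operator in
theorem psd_sqC {β : Type*} [Fintype β] [DecidableEq β] (S : Matrix β β ℂ)
    (hS : S.PosSemidef) : ∃ B, S = Bᴴ * B :=
  CStarAlgebra.nonneg_iff_eq_star_mul_self.1 hS.nonneg

open scoped MatrixOrder Matrix.Norms.L2Operator in
theorem psd_perturbC {β : Type*} [Fintype β] [DecidableEq β] (X : Matrix β β ℂ)
    (hX : X.IsHermitian) (c : ℝ) (hc : 0 < c) : 
    ∃ t : ℝ, 0 < t ∧ ((c : ℂ) • (1 : Matrix β β ℂ) + (t : ℂ) • X).PosSemidef := by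
  have h := IsSelfAdjoint.neg_algebraMap_norm_le_self (a := X) hX
  rw [neg_le_iff_add_nonneg', Matrix.nonneg_iff_posSemidef] at h
  refine ⟨c / (‖X‖ + 1), by positivity, ?_⟩
  have h1 := h.smul (show (0 : ℂ) ≤ ((c / (‖X‖ + 1) : ℝ) : ℂ) by
    rw [Complex.zero_le_real]; positivity)
  have h2 := (Matrix.PosSemidef.one (n := β) (R := ℂ)).smul
    (show (0 : ℂ) ≤ ((c / (‖X‖ + 1) : ℝ) : ℂ) by
    rw [Complex.zero_le_real]; positivity)
  have : (‖X‖ + 1 : ℂ) ≠ 0 := by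
    exact_mod_cast (by positivity : ‖X‖ + 1 ≠ 0)
  have e : (c : ℂ) • (1 : Matrix β β ℂ) + ((c / (‖X‖ + 1) : ℝ) : ℂ) • X =
    ((c / (‖X‖ + 1) : ℝ) : ℂ) • (algebraMap ℝ (Matrix β β ℂ) ‖X‖ + X) +
      ((c / (‖X‖ + 1) : ℝ) : ℂ) • 1 := by
    rw [Algebra.algebraMap_eq_smul_one, ← Complex.coe_smul, smul_add, smul_smul, add_right_comm,
      ← add_smul]
    congr 2
    push_cast
    field_simp
  rw [e]
  exact h1.add h2

theorem psd_ptrMidC {α β γ : Type*} [Fintype α] [Fintype β] [Fintype γ] [DecidableEq α]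
    [DecidableEq β] [DecidableEq γ] (S : Matrix β β ℂ) (M : Matrix (α × β × γ) (α × β × γ) ℂ)
    (hS : S.PosSemidef) (hM : M.PosSemidef) :
    (ptrMid (((1 : Matrix α α ℂ) ⊗ₖ (S ⊗ₖ (1 : Matrix γ γ ℂ))) * M)).PosSemidef := by
  obtain ⟨B, rfl⟩ := psd_sqC S hS
  set K := (1 : Matrix α α ℂ) ⊗ₖ (B ⊗ₖ (1 : Matrix γ γ ℂ)) with hK
  have e : (1 : Matrix α α ℂ) ⊗ₖ ((Bᴴ * B) ⊗ₖ (1 : Matrix γ γ ℂ)) = 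
      ((1 : Matrix α α ℂ) ⊗ₖ (Bᴴ ⊗ₖ (1 : Matrix γ γ ℂ))) * K := by
    rw [hK, ← Matrix.mul_kronecker_mul, ← Matrix.mul_kronecker_mul]; simp
  have e2 : (1 : Matrix α α ℂ) ⊗ₖ (Bᴴ ⊗ₖ (1 : Matrix γ γ ℂ)) = Kᴴ := by
    rw [hK, Matrix.conjTranspose_kronecker, Matrix.conjTranspose_kronecker]; simp
  rw [e, Matrix.mul_assoc, ptrMid_cycC, e2]
  have h := hM.mul_mul_conjTranspose_same K
  have : ptrMid (K * M * Kᴴ) = ∑ b : β, (K * M * Kᴴ).submatrix (fun p : α × γ => (p.1, b, p.2)) (fun p : α × γ => (p.1, b, p.2)) := by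
    ext u v
    rw [Matrix.sum_apply]; rfl
  rw [this]
  exact Matrix.posSemidef_sum _ fun b _ => h.submatrix _

theorem splitEnds_symmC (H : ℕ → Type) (k : ℕ) (a : H 0) (s : ∀ j : Fin k, H (j + 1)) (b : H (k + 1)) :
    (splitEnds H k).symm (a, s, b) = Fin.snoc (α := fun j : Fin (k + 1 + 1) => H j)
      (Fin.cons (α := fun j : Fin (k + 1) => H j) a s) b := by
  rw [Equiv.symm_apply_eq, ← cons_snocC]
  refine Prod.ext rfl (Prod.ext ?_ ?_)
  · funext j
    symm
    exact Fin.snoc_castSucc (α := fun j : Fin (k + 1) => H (j + 1)) b s j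
  · symm
    exact Fin.snoc_last (α := fun j : Fin (k + 1) => H (j + 1)) b s

theorem comb_trC {H : ℕ → Type} [∀ j, Fintype (H j)] [∀ j, DecidableEq (H j)] (k : ℕ)
    (S : Matrix (∀ j : Fin k, H (j + 1)) (∀ j : Fin k, H (j + 1)) ℂ)
    (R : Matrix (∀ j : Fin (k + 2), H j) (∀ j : Fin (k + 2), H j) ℂ) 
    (hS : S.PosSemidef) (hR : R.PosSemidef) :
    ptrMid (((1 : Matrix (H 0) (H 0) ℂ) ⊗ₖ
          (S ⊗ₖ (1 : Matrix (H (k + 1)) (H (k + 1)) ℂ))) *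
        (Matrix.reindex (splitEnds H k) (splitEnds H k) R)) ∈
      comb1Set (H 0) (H (k + 1)) ↔ pairC k S (trLast (k + 1) R) = 1 := by
  have h : (ptrMid (((1 : Matrix (H 0) (H 0) ℂ) ⊗ₖ
          (S ⊗ₖ (1 : Matrix (H (k + 1)) (H (k + 1)) ℂ))) *
        (Matrix.reindex (splitEnds H k) (splitEnds H k) R))).PosSemidef :=
    psd_ptrMidC _ _ hS (hR.submatrix _)
  unfold comb1Set
  rw [Set.mem_ofPred_eq]
  refine (and_iff_right h).trans ?_
  refine Eq.congr_left ?_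
  funext a a'
  unfold pairC trLast ptrMid
  simp only [Matrix.mul_apply, Fintype.sum_prod_type, Matrix.kroneckerMap_apply, Matrix.one_apply]
  simp only [ite_mul, mul_ite, one_mul, zero_mul, mul_one, mul_zero, Finset.sum_ite_eq, Finset.sum_ite_eq', Finset.sum_const_zero, Finset.mem_univ, if_true, Finset.sum_ite_irrel]
  rw [Finset.sum_comm]
  refine Finset.sum_congr rfl fun s _ => ?_
  rw [Finset.sum_comm]
  refine Finset.sum_congr rfl fun s' _ => ?_
  rw [Finset.mul_sum]
  refine Finset.sum_congr rfl fun b _ => ?_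
  rw [Matrix.reindex_apply, Matrix.submatrix_apply, splitEnds_symmC, splitEnds_symmC]

def ChainC (H : ℕ → Type) [∀ j, Fintype (H j)] [∀ j, DecidableEq (H j)] : (n : ℕ) →
    Set (Matrix (∀ j : Fin (2 * n + 2), H j) (∀ j : Fin (2 * n + 2), H j) ℂ)
  | 0 => {R | R.PosSemidef ∧ trLast 1 R = 1}
  | (n + 1) => {R | R.PosSemidef ∧ ∃ R' ∈ ChainC H n,
      trLast (2 * n + 2 + 1) R = tensorIdLast (2 * n + 2) R'}

theorem mem_chain_zero {H : ℕ → Type} [∀ j, Fintype (H j)] [∀ j, DecidableEq (H j)] 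
    {R : Matrix (∀ j : Fin (2 * 0 + 2), H j) (∀ j : Fin (2 * 0 + 2), H j) ℂ} :
    R ∈ ChainC H 0 ↔ R.PosSemidef ∧ trLast 1 R = 1 := Iff.rfl

theorem mem_chain_succ {H : ℕ → Type} [∀ j, Fintype (H j)] [∀ j, DecidableEq (H j)] {n : ℕ} 
    {R : Matrix (∀ j : Fin (2 * (n + 1) + 2), H j) (∀ j : Fin (2 * (n + 1) + 2), H j) ℂ} :
    R ∈ ChainC H (n + 1) ↔ R.PosSemidef ∧ ∃ R' ∈ ChainC H n,
      trLast (2 * n + 2 + 1) R = tensorIdLast (2 * n + 2) R' := Iff.rfl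

theorem chain_psd {H : ℕ → Type} [∀ j, Fintype (H j)] [∀ j, DecidableEq (H j)] {n : ℕ}
    {R : Matrix (∀ j : Fin (2 * n + 2), H j) (∀ j : Fin (2 * n + 2), H j) ℂ}
    (h : R ∈ ChainC H n) : R.PosSemidef := by
  cases n with
  | zero => exact h.1
  | succ n => exact h.1

/-- being a chain only depends on positivity and the last partial trace -/
theorem chain_congr {H : ℕ → Type} [∀ j, Fintype (H j)] [∀ j, DecidableEq (H j)] {n : ℕ}
    {R R₂ : Matrix (∀ j : Fin (2 * n + 2), H j) (∀ j : Fin (2 * n + 2), H j) ℂ}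
    (h : R ∈ ChainC H n) (hR₂ : R₂.PosSemidef) (e : trLast (2 * n + 1) R₂ = trLast (2 * n + 1) R) :
    R₂ ∈ ChainC H n := by
  cases n with
  | zero => exact ⟨hR₂, e.trans h.2⟩
  | succ n => 
    obtain ⟨_, R', h1, h2⟩ := h
    exact ⟨hR₂, R', h1, e.trans h2⟩

theorem pairC_add {H : ℕ → Type} [∀ j, Fintype (H j)] (k : ℕ)
    (S S' : Matrix (∀ j : Fin k, H (j + 1)) (∀ j : Fin k, H (j + 1)) ℂ)
    (T : Matrix (∀ j : Fin (k + 1), H j) (∀ j : Fin (k + 1), H j) ℂ) :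
    pairC k (S + S') T = pairC k S T + pairC k S' T := by
  ext a a'
  simp [pairC, add_mul, Finset.sum_add_distrib]

theorem pairC_smul {H : ℕ → Type} [∀ j, Fintype (H j)] (k : ℕ) (c : ℂ)
    (S : Matrix (∀ j : Fin k, H (j + 1)) (∀ j : Fin k, H (j + 1)) ℂ)
    (T : Matrix (∀ j : Fin (k + 1), H j) (∀ j : Fin (k + 1), H j) ℂ) :
    pairC k (c • S) T = c • pairC k S T := by
  ext a a'
  simp [pairC, Finset.mul_sum, mul_assoc]

theorem pairC_smul_right {H : ℕ → Type} [∀ j, Fintype (H j)] (k : ℕ) (c : ℂ)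
    (S : Matrix (∀ j : Fin k, H (j + 1)) (∀ j : Fin k, H (j + 1)) ℂ)
    (T : Matrix (∀ j : Fin (k + 1), H j) (∀ j : Fin (k + 1), H j) ℂ) :
    pairC k S (c • T) = c • pairC k S T := by
  ext a a'
  simp only [pairC, Finset.mul_sum, Matrix.smul_apply, smul_eq_mul]
  simp only [mul_left_comm]

theorem trLast_addC {H : ℕ → Type} [∀ j, Fintype (H j)] (k : ℕ)
    (R S : Matrix (∀ j : Fin (k + 1), H j) (∀ j : Fin (k + 1), H j) ℂ) :
    trLast k (R + S) = trLast k R + trLast k S := by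
  ext a a'
  simp [trLast, Finset.sum_add_distrib]

theorem trLast_smulC {H : ℕ → Type} [∀ j, Fintype (H j)] (k : ℕ) (c : ℂ)
    (R : Matrix (∀ j : Fin (k + 1), H j) (∀ j : Fin (k + 1), H j) ℂ) :
    trLast k (c • R) = c • trLast k R := by
  ext a a'
  simp [trLast, Finset.mul_sum]

theorem trLast_starC {H : ℕ → Type} [∀ j, Fintype (H j)] (k : ℕ)
    (R : Matrix (∀ j : Fin (k + 1), H j) (∀ j : Fin (k + 1), H j) ℂ) :
    trLast k Rᴴ = (trLast k R)ᴴ := by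
  ext a a'
  simp [trLast, Matrix.conjTranspose_apply]

theorem tensor_smulC {H : ℕ → Type} [∀ j, Fintype (H j)] [∀ j, DecidableEq (H j)] (k : ℕ) (c : ℂ)
    (R : Matrix (∀ j : Fin k, H j) (∀ j : Fin k, H j) ℂ) :
    tensorIdLast k (c • R) = c • tensorIdLast k R := by
  ext a a'
  simp [tensorIdLast]

theorem chain_pair (n : ℕ) {H : ℕ → Type} [∀ j, Fintype (H j)] [∀ j, DecidableEq (H j)]
    (R : Matrix (∀ j : Fin (2 * (n + 1) + 2), H j) (∀ j : Fin (2 * (n + 1) + 2), H j) ℂ)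
    (hR : R ∈ ChainC H (n + 1))
    (S : Matrix (∀ j : Fin (2 * n + 2), H (j + 1)) (∀ j : Fin (2 * n + 2), H (j + 1)) ℂ)
    (hS : S ∈ ChainC (fun m => H (m + 1)) n) :
    pairC (2 * n + 2) S (trLast (2 * n + 2 + 1) R) = 1 := by
  induction n with
  | zero =>
    obtain ⟨_, R', hR', e⟩ := hR
    rw [e]
    refine (pairC_tensor_right _ S R').trans ?_
    have h2 := hS.2
    have h3 : trLast (H := fun m => H (m + 1)) (2 * 0 + 1) S = 1 := h2
    rw [h3, ← tensor_oneC (H := fun m => H (m + 1))]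
    refine (pairC_tensor_left (2 * 0) _ R').trans ?_
    exact (pairC_zero _).2 hR'.2
  | succ n ih =>
    obtain ⟨_, R', hR', e⟩ := hR
    rw [e]
    refine (pairC_tensor_right _ S R').trans ?_
    obtain ⟨_, S', hS', e'⟩ := hS
    have h3 : trLast (H := fun m => H (m + 1)) (2 * (n + 1) + 1) S =
      tensorIdLast (H := fun m => H (m + 1)) (2 * n + 2) S' := e'
    rw [h3]
    refine (pairC_tensor_left (2 * n + 2) _ R').trans ?_
    exact ih R' hR' S' hS'

theorem chain_extend {n : ℕ} {H : ℕ → Type} [∀ j, Fintype (H j)] [∀ j, DecidableEq (H j)]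
    (R : Matrix (∀ j : Fin (2 * n + 2), H j) (∀ j : Fin (2 * n + 2), H j) ℂ)
    (hR : R ∈ ChainC H n)
    (hne : Nonempty (H (2 * n + 3)) ∨ IsEmpty (∀ j : Fin (2 * n + 3), H j)) :
    ((Fintype.card (H (2 * n + 3)) : ℂ)⁻¹ •
      tensorIdLast (2 * n + 3) (tensorIdLast (2 * n + 2) R) :
      Matrix (∀ j : Fin (2 * (n + 1) + 2), H j) (∀ j : Fin (2 * (n + 1) + 2), H j) ℂ) ∈
      ChainC H (n + 1) := by
  refine mem_chain_succ.2 ⟨?_, R, hR, ?_⟩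
  · refine (psd_tensorC _ _ (psd_tensorC _ _ (chain_psd hR))).smul ?_
    rw [← Complex.ofReal_natCast, ← Complex.ofReal_inv, Complex.zero_le_real]
    positivity
  · rcases hne with h | h
    · refine (trLast_smulC (2 * n + 3) _ _).trans ?_
      rw [trLast_tensorC, smul_smul, inv_mul_cancel₀, one_smul]
      exact_mod_cast Fintype.card_ne_zero
    · ext u v
      exact h.elim u

theorem chain_base {H : ℕ → Type} [∀ j, Fintype (H j)] [∀ j, DecidableEq (H j)]
    (hne : Nonempty (H 1) ∨ IsEmpty (H 0)) :
    ((Fintype.card (H 1) : ℂ)⁻¹ • 1 :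
      Matrix (∀ j : Fin (2 * 0 + 2), H j) (∀ j : Fin (2 * 0 + 2), H j) ℂ) ∈ ChainC H 0 := by
  refine mem_chain_zero.2 ⟨?_, ?_⟩
  · refine Matrix.PosSemidef.one.smul ?_
    rw [← Complex.ofReal_natCast, ← Complex.ofReal_inv, Complex.zero_le_real]
    positivity
  · rcases hne with h | h
    · refine (trLast_smulC 1 _ _).trans ?_
      refine (congrArg _ (congrArg (trLast (H := H) 1) (tensor_oneC (H := H) 1).symm)).trans ?_
      rw [trLast_tensorC, smul_smul, inv_mul_cancel₀, one_smul]
      exact_mod_cast Fintype.card_ne_zero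
    · ext u v
      exact h.elim (u 0)

theorem chain_nonempty (n : ℕ) {H : ℕ → Type} [∀ j, Fintype (H j)] [∀ j, DecidableEq (H j)]
    (h : ∀ j ≤ n, IsEmpty (H (2 * j + 1)) → ∃ i ≤ j, IsEmpty (H (2 * i))) :
    (ChainC H n).Nonempty := by
  induction n with
  | zero =>
    refine ⟨_, chain_base ?_⟩
    rcases isEmpty_or_nonempty (H 1) with h1 | h1
    · obtain ⟨i, hi, h2⟩ := h 0 le_rfl h1
      obtain rfl : i = 0 := by omega
      exact Or.inr h2
    · exact Or.inl h1
  | succ n ih =>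
    obtain ⟨R, hR⟩ := ih fun j hj => h j (by omega)
    refine ⟨_, chain_extend R hR ?_⟩
    rcases isEmpty_or_nonempty (H (2 * n + 3)) with h1 | h1
    · obtain ⟨i, hi, h2⟩ := h (n + 1) le_rfl h1
      exact Or.inr ⟨fun u => h2.elim (u ⟨2 * i, by omega⟩)⟩
    · exact Or.inl h1

theorem chain_one (n : ℕ) {H : ℕ → Type} [∀ j, Fintype (H j)] [∀ j, DecidableEq (H j)]
    (h : ∀ j ≤ n, Nonempty (H (2 * j + 1))) :
    ∃ c : ℝ, 0 < c ∧ ((c : ℂ) • 1 : Matrix (∀ j : Fin (2 * n + 2), H j) (∀ j : Fin (2 * n + 2), H j) ℂ) ∈ ChainC H n := by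
  induction n with
  | zero =>
    have : Nonempty (H 1) := h 0 le_rfl
    refine ⟨(Fintype.card (H 1) : ℝ)⁻¹, ?_, ?_⟩
    · have := Fintype.card_pos (α := H 1)
      positivity
    · have := chain_base (H := H) (Or.inl this)
      push_cast
      exact this
  | succ n ih =>
    obtain ⟨c, hc, hR⟩ := ih fun j hj => h j (by omega)
    have : Nonempty (H (2 * n + 3)) := h (n + 1) le_rfl
    have h2 := chain_extend _ hR (Or.inl this)
    refine ⟨(Fintype.card (H (2 * n + 3)) : ℝ)⁻¹ * c, ?_, ?_⟩
    · have := Fintype.card_pos (α := H (2 * n + 3))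
      positivity
    · rw [tensor_smulC, tensor_smulC, tensor_oneC, smul_smul] at h2
      erw [tensor_oneC] at h2
      push_cast
      exact h2

theorem pair_traceless {n : ℕ} {H : ℕ → Type} [∀ j, Fintype (H j)] [∀ j, DecidableEq (H j)]
    (T : Matrix (∀ j : Fin (2 * n + 2 + 1), H j) (∀ j : Fin (2 * n + 2 + 1), H j) ℂ)
    (h : ∀ S ∈ ChainC (fun m => H (m + 1)) n, pairC (2 * n + 2) S T = 1)
    (hne : ∀ j ≤ n, Nonempty (H (2 * j + 1 + 1)))
    (X : Matrix (∀ j : Fin (2 * n + 2), H (j + 1)) (∀ j : Fin (2 * n + 2), H (j + 1)) ℂ)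
    (hX : trLast (H := fun m => H (m + 1)) (2 * n + 1) X = 0) :
    pairC (2 * n + 2) X T = 0 := by
  have herm : ∀ X : Matrix (∀ j : Fin (2 * n + 2), H (j + 1)) (∀ j : Fin (2 * n + 2), H (j + 1)) ℂ,
      trLast (H := fun m => H (m + 1)) (2 * n + 1) X = 0 → X.IsHermitian → 
      pairC (2 * n + 2) X T = 0 := by
    intro X hX hH
    obtain ⟨c, hc, hcc⟩ := chain_one (H := fun m => H (m + 1)) n hne
    obtain ⟨t, ht, hp⟩ := psd_perturbC X hH c hc
    have h1 := h _ hcc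
    have h2 := h _ (chain_congr hcc hp (by
      rw [trLast_addC, trLast_smulC (H := fun m => H (m + 1)) _ _ X, hX, smul_zero, add_zero]))
    rw [pairC_add, h1, pairC_smul, add_eq_left] at h2
    exact (smul_eq_zero.1 h2).resolve_left (by exact_mod_cast ht.ne')
  have hX2 : trLast (H := fun m => H (m + 1)) (2 * n + 1) Xᴴ = 0 := by
    rw [trLast_starC, hX, Matrix.conjTranspose_zero]
  have a1 := herm (X + Xᴴ) (by rw [trLast_addC, hX, hX2, add_zero])
    (by simp [Matrix.IsHermitian, add_comm])
  have a2 := herm (Complex.I • X + (-Complex.I) • Xᴴ)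
    (by rw [trLast_addC, trLast_smulC, trLast_smulC, hX, hX2]; simp)
    (by simp [Matrix.IsHermitian, add_comm])
  rw [pairC_add] at a1
  rw [pairC_add, pairC_smul, pairC_smul] at a2
  have a3 : pairC (2 * n + 2) Xᴴ T = - pairC (2 * n + 2) X T := by
    rw [eq_neg_iff_add_eq_zero, add_comm]; exact a1
  rw [a3, smul_neg, neg_smul, neg_neg, ← add_smul] at a2
  exact (smul_eq_zero.1 a2).resolve_left (by simp [← two_mul])

theorem pair_single (k : ℕ) {H : ℕ → Type} [∀ j, Fintype (H j)] [∀ j, DecidableEq (H j)]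
    (M : Matrix (∀ j : Fin (k + 1), H j) (∀ j : Fin (k + 1), H j) ℂ)
    (u v : ∀ j : Fin (k + 1), H j) :
    pairC k (Matrix.single (fun j : Fin k => v j.succ) (fun j : Fin k => u j.succ) 1) M
      (u 0) (v 0) = M u v := by
  obtain ⟨v', hv'⟩ : ∃ v' : (∀ j : Fin k, H (j + 1)), v' = fun j : Fin k => v j.succ := ⟨_, rfl⟩
  obtain ⟨u', hu'⟩ : ∃ u' : (∀ j : Fin k, H (j + 1)), u' = fun j : Fin k => u j.succ := ⟨_, rfl⟩
  have eu : u = Fin.cons (α := fun j : Fin (k + 1) => H j) (u 0) u' := by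
    rw [hu']; exact (Fin.cons_self_tail u).symm
  have ev : v = Fin.cons (α := fun j : Fin (k + 1) => H j) (v 0) v' := by
    rw [hv']; exact (Fin.cons_self_tail v).symm
  have main : pairC k (Matrix.single v' u' 1) M (u 0) (v 0) =
      M (Fin.cons (α := fun j : Fin (k + 1) => H j) (u 0) u')
        (Fin.cons (α := fun j : Fin (k + 1) => H j) (v 0) v') := by
    unfold pairC
    refine (Finset.sum_eq_single v' ?_ ?_).trans
      ((Finset.sum_eq_single u' ?_ ?_).trans ?_)
    · intro b _ hb
      refine Finset.sum_eq_zero fun s _ => ?_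
      rw [Matrix.single_apply_of_ne, zero_mul]
      exact fun h => hb h.1.symm
    · intro h; exact absurd (Finset.mem_univ _) h
    · intro b _ hb
      rw [Matrix.single_apply_of_ne, zero_mul]
      exact fun h => hb h.2.symm
    · intro h; exact absurd (Finset.mem_univ _) h
    · rw [Matrix.single_apply_same, one_mul]
  rw [← eu, ← ev, hu', hv'] at main
  exact main

theorem eq_tensor {k : ℕ} {H : ℕ → Type} [∀ j, Fintype (H j)] [∀ j, DecidableEq (H j)]
    (T : Matrix (∀ j : Fin (k + 1 + 1), H j) (∀ j : Fin (k + 1 + 1), H j) ℂ)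
    [Nonempty (H (k + 1))]
    (h : ∀ X, trLast (H := fun m => H (m + 1)) k X = 0 → pairC (k + 1) X T = 0) :
    T = tensorIdLast (k + 1) ((Fintype.card (H (k + 1)) : ℂ)⁻¹ • trLast (k + 1) T) := by
  have hd : (Fintype.card (H (k + 1)) : ℂ) ≠ 0 := by exact_mod_cast Fintype.card_ne_zero
  have key : ∀ Y : Matrix (∀ j : Fin (k + 1), H (j + 1)) (∀ j : Fin (k + 1), H (j + 1)) ℂ,
      pairC (k + 1) Y T = pairC (k + 1) Y 
        (tensorIdLast (k + 1) ((Fintype.card (H (k + 1)) : ℂ)⁻¹ • trLast (k + 1) T)) := by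
    intro Y
    have h1 := h (Y + (-(Fintype.card (H (k + 1)) : ℂ)⁻¹) • 
      tensorIdLast (H := fun m => H (m + 1)) k (trLast (H := fun m => H (m + 1)) k Y)) (by
        rw [trLast_addC, trLast_smulC, trLast_tensorC, smul_smul, neg_mul, inv_mul_cancel₀ hd]
        simp)
    rw [pairC_add, pairC_smul, pairC_tensor_left, neg_smul, ← sub_eq_add_neg, sub_eq_zero] at h1
    rw [h1, pairC_tensor_right, pairC_smul_right]
  ext u v
  have e := fun M => pair_single (k + 1) M u v
  have := congrFun (congrFun (key (Matrix.single (fun j : Fin (k + 1) => v j.succ)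
    (fun j : Fin (k + 1) => u j.succ) 1)) (u 0)) (v 0)
  exact (e _).symm.trans (this.trans (e _))

theorem chain_of_pair_aux (n : ℕ) {H : ℕ → Type} [∀ j, Fintype (H j)] [∀ j, DecidableEq (H j)]
    (hne : ∀ j ≤ n, Nonempty (H (2 * j + 1 + 1)))
    (R : Matrix (∀ j : Fin (2 * (n + 1) + 2), H j) (∀ j : Fin (2 * (n + 1) + 2), H j) ℂ)
    (hR : R.PosSemidef)
    (h : ∀ S ∈ ChainC (fun m => H (m + 1)) n,
      pairC (2 * n + 2) S (trLast (2 * n + 2 + 1) R) = 1) :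
    R ∈ ChainC H (n + 1) := by
  induction n with
  | zero =>
    have hn : Nonempty (H (2 * 0 + 1 + 1)) := hne 0 le_rfl
    have e := eq_tensor (k := 2 * 0 + 1) _ (pair_traceless _ h hne)
    refine mem_chain_succ.2 ⟨hR, _, mem_chain_zero.2 ⟨?_, ?_⟩, e⟩
    · refine (psd_trLastC _ _ (psd_trLastC _ _ hR)).smul ?_
      rw [← Complex.ofReal_natCast, ← Complex.ofReal_inv, Complex.zero_le_real]
      positivity
    · have h1 := h _ (chain_base (H := fun m => H (m + 1)) (Or.inl hn))
      refine (pairC_zero _).1 ?_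
      refine (pairC_tensor_left 0 _ _).symm.trans ?_
      rw [tensor_oneC, pairC_smul_right]
      rw [pairC_smul, ← tensor_oneC (H := fun m => H (m + 1))] at h1
      erw [pairC_tensor_left] at h1
      exact h1
  | succ n ih =>
    have hn : Nonempty (H (2 * (n + 1) + 1 + 1)) := hne (n + 1) le_rfl
    have e := eq_tensor (k := 2 * (n + 1) + 1) _ (pair_traceless _ h hne)
    refine mem_chain_succ.2 ⟨hR, _, ih (fun j hj => hne j (by omega)) _ ?_ ?_, e⟩
    · refine (psd_trLastC _ _ (psd_trLastC _ _ hR)).smul ?_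
      rw [← Complex.ofReal_natCast, ← Complex.ofReal_inv, Complex.zero_le_real]
      positivity
    · intro S hS
      have h1 := h _ (chain_extend _ hS (Or.inl hn))
      refine (pairC_tensor_left (2 * n + 2) _ _).symm.trans ?_
      rw [pairC_smul_right]
      rw [pairC_smul] at h1
      refine Eq.trans ?_ h1
      congr 1
      exact (pairC_tensor_left (2 * n + 3) _ _).symm

theorem chain_of_pair (n : ℕ) {H : ℕ → Type} [∀ j, Fintype (H j)] [∀ j, DecidableEq (H j)]
    (R : Matrix (∀ j : Fin (2 * (n + 1) + 2), H j) (∀ j : Fin (2 * (n + 1) + 2), H j) ℂ)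
    (hR : R.PosSemidef)
    (h : ∀ S ∈ ChainC (fun m => H (m + 1)) n,
      pairC (2 * n + 2) S (trLast (2 * n + 2 + 1) R) = 1) :
    R ∈ ChainC H (n + 1) := by
  by_cases hne : ∀ j ≤ n, Nonempty (H (2 * j + 1 + 1))
  · exact chain_of_pair_aux n hne R hR h
  push Not at hne
  obtain ⟨j, hj, he⟩ := hne
  have he' : IsEmpty (∀ j : Fin (2 * (n + 1) + 2), H j) :=
    ⟨fun u => he.elim (u ⟨2 * j + 1 + 1, by omega⟩)⟩
  have he2 : IsEmpty (∀ j : Fin (2 * n + 2 + 1), H j) :=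
    ⟨fun u => he.elim (u ⟨2 * j + 1 + 1, by omega⟩)⟩
  suffices hc : (ChainC H (n + 1)).Nonempty by
    obtain ⟨R₂, hR₂⟩ := hc
    have : R = R₂ := by
      ext u v; exact he'.elim u
    rwa [this]
  rcases isEmpty_or_nonempty (H 0) with h0 | ⟨⟨a⟩⟩
  · exact chain_nonempty _ fun j _ _ => ⟨0, by omega, h0⟩
  by_cases hc : ∀ j ≤ n, IsEmpty (H (2 * j + 1 + 1)) → ∃ i ≤ j, IsEmpty (H (2 * i + 1))
  · obtain ⟨S, hS⟩ := chain_nonempty (H := fun m => H (m + 1)) n hc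
    have := congrFun (congrFun (h S hS) a) a
    rw [Matrix.one_apply_eq] at this
    exfalso
    refine zero_ne_one (α := ℂ) (Eq.trans ?_ this)
    symm
    refine Finset.sum_eq_zero fun s _ => ?_
    exact he2.elim (Fin.cons (α := fun j : Fin (2 * n + 2 + 1) => H j) a s)
  · push Not at hc
    obtain ⟨j, hj, hej, hno⟩ := hc
    refine chain_nonempty _ fun i hi hei => ?_
    rcases lt_or_ge j i with hij | hij
    · exact ⟨j + 1, hij, hej⟩
    · obtain ⟨x⟩ := hno i hij
      exact hei.elim x

theorem comb_eq_chain (n : ℕ) (H : ℕ → Type) [∀ j, Fintype (H j)] [∀ j, DecidableEq (H j)]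
    (R : Matrix (∀ j : Fin (2 * n + 2), H j) (∀ j : Fin (2 * n + 2), H j) ℂ) :
    R ∈ Comb (n + 1) H ↔ R ∈ ChainC H n := by
  induction n generalizing H with
  | zero => exact Iff.rfl
  | succ n ih =>
    constructor
    · rintro ⟨hR, h⟩
      refine chain_of_pair n R hR fun S hS => ?_
      exact (comb_trC (2 * n + 2) S R (chain_psd hS) hR).1 (h S ((ih (fun m => H (m + 1)) S).2 hS))
    · intro h
      refine ⟨h.1, fun S hS => ?_⟩
      have hS' := (ih (fun m => H (m + 1)) S).1 hS
      exact (comb_trC (2 * n + 2) S R (chain_psd hS') h.1).2 (chain_pair n R h S hS')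

theorem chain_iff_seq (n : ℕ) (H : ℕ → Type) [∀ j, Fintype (H j)] [∀ j, DecidableEq (H j)]
    (R : Matrix (∀ j : Fin (2 * n + 2), H j) (∀ j : Fin (2 * n + 2), H j) ℂ) :
    R ∈ ChainC H n ↔ ∃ Rs : (j : ℕ) →
          Matrix (∀ i : Fin (2 * j + 2), H i) (∀ i : Fin (2 * j + 2), H i) ℂ,
      (∀ j ≤ n, (Rs j).PosSemidef) ∧ Rs n = R ∧ 
      (∀ j < n, trLast (2 * j + 2 + 1) (Rs (j + 1)) = tensorIdLast (2 * j + 2) (Rs j)) ∧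
      trLast 1 (Rs 0) = 1 := by
  induction n with
  | zero =>
    constructor
    · intro h
      refine ⟨Function.update (fun _ => 0) 0 R, ?_, ?_, ?_, ?_⟩
      · intro j hj
        obtain rfl : j = 0 := by omega
        rw [Function.update_self]; exact h.1
      · rw [Function.update_self]
      · intro j hj; omega
      · rw [Function.update_self]; exact h.2
    · rintro ⟨Rs, h1, rfl, -, h3⟩
      exact ⟨h1 0 le_rfl, h3⟩
  | succ n ih =>
    constructor
    · rintro ⟨hp, R', hR', e⟩
      obtain ⟨Rs, h1, rfl, h2, h3⟩ := (ih R').1 hR'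
      refine ⟨Function.update Rs (n + 1) R, ?_, ?_, ?_, ?_⟩
      · intro j hj
        rcases eq_or_ne j (n + 1) with rfl | hne
        · rw [Function.update_self]; exact hp
        · rw [Function.update_of_ne hne]; exact h1 j (by omega)
      · rw [Function.update_self]
      · intro j hj
        rcases eq_or_ne j n with rfl | hne
        · rw [Function.update_self, Function.update_of_ne (by omega)]; exact e
        · rw [Function.update_of_ne (by omega), Function.update_of_ne (by omega)]
          exact h2 j (by omega)
      · rw [Function.update_of_ne (by omega)]; exact h3
    · rintro ⟨Rs, h1, rfl, h2, h3⟩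
      refine ⟨h1 _ le_rfl, Rs n, (ih _).2 ⟨Rs, fun j hj => h1 j (by omega), rfl, fun j hj => h2 j (by omega), h3⟩, h2 n (by omega)⟩

/-- a PSD operator `R` on `H_0⊗⋯⊗H_{2n−1}` is a deterministic `n`-comb iff
there exist PSD operators `R⁽ʲ⁾` on `H_0⊗⋯⊗H_{2j+1}` (`j = 0,…,n−1`) with `R⁽ⁿ⁻¹⁾ = R`,
`Tr_{H_{2j+1}}[R⁽ʲ⁾] = R⁽ʲ⁻¹⁾⊗I_{H_{2j}}` for `1 ≤ j ≤ n−1`, and `Tr_{H_1}[R⁽⁰⁾] = I_{H_0}`. -/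
theorem stmt_3 (n : ℕ) (hn : 1 ≤ n) (H : ℕ → Type)
    [∀ j, Fintype (H j)] [∀ j, DecidableEq (H j)]
    (R : Matrix (∀ j : Fin (2 * n), H j) (∀ j : Fin (2 * n), H j) ℂ)
    (hR : R.PosSemidef) :
    R ∈ Comb n H ↔
      ∃ Rs : (j : ℕ) → j < n →
          Matrix (∀ i : Fin (2 * j + 2), H i) (∀ i : Fin (2 * j + 2), H i) ℂ,
        (∀ j (hj : j < n), (Rs j hj).PosSemidef) ∧
        (Matrix.reindex (piFinCast H (by omega : 2 * (n - 1) + 2 = 2 * n))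
            (piFinCast H (by omega : 2 * (n - 1) + 2 = 2 * n))
            (Rs (n - 1) (by omega)) = R) ∧
        (∀ (j : ℕ) (hj : j < n) (h1j : 1 ≤ j),
          trLast (2 * j + 1) (Rs j hj) =
            tensorIdLast (2 * j)
              (Matrix.reindex (piFinCast H (by omega : 2 * (j - 1) + 2 = 2 * j))
                (piFinCast H (by omega : 2 * (j - 1) + 2 = 2 * j))
                (Rs (j - 1) (by omega)))) ∧
        trLast 1 (Rs 0 (by omega)) =
          (1 : Matrix (∀ i : Fin 1, H i) (∀ i : Fin 1, H i) ℂ) := by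
  obtain ⟨n, rfl⟩ : ∃ m, n = m + 1 := ⟨n - 1, by omega⟩
  refine (comb_eq_chain n H R).trans ((chain_iff_seq n H R).trans ?_)
  constructor
  · rintro ⟨Rs, h1, h2, h3, h4⟩
    refine ⟨fun j _ => Rs j, fun j hj => h1 j (by omega), h2, ?_, h4⟩
    intro j hj h1j
    obtain ⟨j, rfl⟩ : ∃ m, j = m + 1 := ⟨j - 1, by omega⟩
    exact h3 j (by omega)
  · rintro ⟨Rs, h1, h2, h3, h4⟩
    refine ⟨fun j => if h : j < n + 1 then Rs j h else 0, ?_, ?_, ?_, ?_⟩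
    · intro j hj
      beta_reduce; rw [dif_pos (by omega)]; exact h1 j _
    · beta_reduce; rw [dif_pos (by omega)]; exact h2
    · intro j hj
      beta_reduce; rw [dif_pos (by omega), dif_pos (by omega)]
      exact h3 (j + 1) (by omega) (by omega)
    · beta_reduce; rw [dif_pos (by omega)]; exact h4

end
end

section
/- Let (λ_x, Δ_x) be a type datum on H_x and (λ_y, Δ_y) a type datum on H_y, with deterministic sets D_x and D_y. Define D(x→y) := { R : R is a PSD operator on H_x⊗H_y and for every X ∈ D_x the partial trace Tr_{H_x}[(X⊗I_{H_y})·R] belongs to D_y }. Then D(x→y) = { R : R PSD on H_x⊗H_y and R − (λ_y/(λ_x·dim H_x))·I ∈ Δ_{x→y} }, where Δ_{x→y} := (Δ̄_x⊗Γ_{H_y}) + (Γ_{H_x}⊗Δ_y) + (Δ̄_x⊗Δ_y) + (Δ_x⊗Δ_y) + (Δ̄_x⊗Δ̄_y). In particular (λ_y/(λ_x·dim H_x))·I ∈ D(x→y). -/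
open Matrix Kronecker ComplexOrder

noncomputable section

/-- The deterministic set `D(λ,Δ)` of a type datum `(λ,Δ)`: positive semidefinite operators
`X` with `X − λ·I ∈ Δ`. -/
def detSet {ι : Type*} [Fintype ι] [DecidableEq ι] (lam : ℝ) (Δ : Set (Matrix ι ι ℂ)) :
    Set (Matrix ι ι ℂ) :=
  {X | X.PosSemidef ∧ X - lam • (1 : Matrix ι ι ℂ) ∈ Δ}

/-- `Δ̄`: the orthogonal complement of `ℝ·I ⊕ Δ` inside the Hermitian operators on `H`,
with respect to the Hilbert–Schmidt inner product `⟪A,B⟫ = Tr[AB]`. -/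
def hermComp {ι : Type*} [Fintype ι] [DecidableEq ι] (Δ : Submodule ℝ (Matrix ι ι ℂ)) :
    Set (Matrix ι ι ℂ) :=
  {Y | Y.IsHermitian ∧
    ∀ X ∈ (Submodule.span ℝ {(1 : Matrix ι ι ℂ)} ⊔ Δ : Submodule ℝ (Matrix ι ι ℂ)),
      (X * Y).trace = 0}

/-- The partial trace over the first tensor factor. -/
def ptrLeft {α β : Type*} [Fintype α] (M : Matrix (α × β) (α × β) ℂ) : Matrix β β ℂ :=
  fun b b' => ∑ a, M (a, b) (a, b')

/-- `V⊗W`: the ℝ-span of `{v ⊗ w : v ∈ V, w ∈ W}` inside the operators on `H_x⊗H_y`. -/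
def tensSpan {α β : Type*} (V : Set (Matrix α α ℂ)) (W : Set (Matrix β β ℂ)) :
    Submodule ℝ (Matrix (α × β) (α × β) ℂ) :=
  Submodule.span ℝ (Set.image2 (· ⊗ₖ ·) V W)

/-- `Γ_H = ℝ·I` as a set of operators. -/
def gammaSet (ι : Type*) [Fintype ι] [DecidableEq ι] : Set (Matrix ι ι ℂ) :=
  (Submodule.span ℝ {(1 : Matrix ι ι ℂ)} : Submodule ℝ (Matrix ι ι ℂ))

section helpers

set_option linter.unusedSectionVars false

variable {α β : Type} [Fintype α] [DecidableEq α] [Fintype β] [DecidableEq β]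

lemma ptr_entry (X : Matrix α α ℂ) (R : Matrix (α × β) (α × β) ℂ) (b b' : β) :
    ptrLeft ((X ⊗ₖ (1 : Matrix β β ℂ)) * R) b b' = ∑ a, ∑ c, X a c * R (c, b) (a, b') := by
  simp [ptrLeft, Matrix.mul_apply, Fintype.sum_prod_type, Matrix.one_apply]

def Lmap : Matrix α α ℂ →ₗ[ℝ] Matrix (α × β) (α × β) ℂ →ₗ[ℝ] Matrix β β ℂ :=
  LinearMap.mk₂ ℝ (fun X R => ptrLeft ((X ⊗ₖ (1 : Matrix β β ℂ)) * R))
    (by intros; ext b b'; simp [ptr_entry, add_mul, Finset.sum_add_distrib])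
    (by intros; ext b b'; simp [ptr_entry, mul_assoc, Finset.mul_sum])
    (by intros; ext b b'; simp only [ptr_entry, Matrix.add_apply]; simp [mul_add, Finset.sum_add_distrib])
    (by intros; ext b b'; simp only [ptr_entry, Matrix.smul_apply, Finset.smul_sum]; simp [mul_left_comm])

lemma Lmap_apply (X : Matrix α α ℂ) (R : Matrix (α × β) (α × β) ℂ) :
    Lmap X R = ptrLeft ((X ⊗ₖ (1 : Matrix β β ℂ)) * R) := rfl

lemma Lmap_kron (X A : Matrix α α ℂ) (B : Matrix β β ℂ) :
    Lmap X (A ⊗ₖ B) = (X * A).trace • B := by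
  ext b b'
  simp [Lmap_apply, ptr_entry, Matrix.trace, Matrix.mul_apply, Finset.sum_mul, mul_assoc]

lemma ptr_comm (K : Matrix α α ℂ) (M : Matrix (α × β) (α × β) ℂ) :
    ptrLeft ((K ⊗ₖ (1 : Matrix β β ℂ)) * M) = ptrLeft (M * (K ⊗ₖ (1 : Matrix β β ℂ))) := by
  ext b b'
  rw [ptr_entry, Finset.sum_comm]
  simp [ptrLeft, Matrix.mul_apply, Fintype.sum_prod_type, Matrix.one_apply, mul_comm]

open MatrixOrder in
lemma exists_factor {X : Matrix α α ℂ} (hX : X.PosSemidef) : ∃ C : Matrix α α ℂ, X = Cᴴ * C :=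
  CStarAlgebra.nonneg_iff_eq_star_mul_self.mp hX.nonneg

lemma ptr_posSemidef {X : Matrix α α ℂ} {R : Matrix (α × β) (α × β) ℂ}
    (hX : X.PosSemidef) (hR : R.PosSemidef) :
    (ptrLeft ((X ⊗ₖ (1 : Matrix β β ℂ)) * R)).PosSemidef := by
  obtain ⟨C, rfl⟩ := exists_factor hX
  have e : (Cᴴ * C) ⊗ₖ (1 : Matrix β β ℂ) = (Cᴴ ⊗ₖ 1) * (C ⊗ₖ 1) := by
    rw [← Matrix.mul_kronecker_mul, one_mul]
  have e2 : (Cᴴ ⊗ₖ (1 : Matrix β β ℂ)) = (C ⊗ₖ (1 : Matrix β β ℂ))ᴴ := by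
    rw [Matrix.conjTranspose_kronecker, Matrix.conjTranspose_one]
  rw [e, mul_assoc, ptr_comm, e2]
  have hP := hR.mul_mul_conjTranspose_same (C ⊗ₖ (1 : Matrix β β ℂ))
  generalize (C ⊗ₖ (1 : Matrix β β ℂ)) * R * (C ⊗ₖ (1 : Matrix β β ℂ))ᴴ = P at hP
  have e3 : ptrLeft P = ∑ a, P.submatrix (fun b => (a, b)) (fun b => (a, b)) := by
    ext b b'
    simp [ptrLeft, Matrix.sum_apply]
  rw [e3]
  exact Matrix.posSemidef_sum _ fun a _ => hP.submatrix _

lemma trace_real {A B : Matrix α α ℂ} (hA : A.IsHermitian) (hB : B.IsHermitian) :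
    (A * B).trace = (((A * B).trace.re : ℝ) : ℂ) := by
  have h : star (A * B).trace = (A * B).trace := by
    rw [← Matrix.trace_conjTranspose, Matrix.conjTranspose_mul, hA.eq, hB.eq, Matrix.trace_mul_comm]
  exact (Complex.conj_eq_iff_re.mp h).symm

open MatrixOrder Matrix.Norms.L2Operator in
lemma exists_shift {T : Matrix α α ℂ} (hT : T.IsHermitian) :
    ∃ c : ℝ, 0 ≤ c ∧ (c • (1 : Matrix α α ℂ) + T).PosSemidef := by
  refine ⟨‖T‖, norm_nonneg _, ?_⟩
  have h : -algebraMap ℝ (Matrix α α ℂ) ‖T‖ ≤ T :=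
    IsSelfAdjoint.neg_algebraMap_norm_le_self (show IsSelfAdjoint T from hT)
  rw [Matrix.le_iff, sub_neg_eq_add, Algebra.algebraMap_eq_smul_one, add_comm] at h
  exact h

lemma exists_psd {l : ℝ} (hl : 0 < l) {T : Matrix α α ℂ} (hT : T.IsHermitian) :
    ∃ e : ℝ, 0 < e ∧ (l • (1 : Matrix α α ℂ) + e • T).PosSemidef := by
  obtain ⟨c, hc, h⟩ := exists_shift hT
  have h1 : ((c + 1) • (1 : Matrix α α ℂ) + T).PosSemidef := by
    rw [add_smul, one_smul, add_right_comm]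
    exact h.add Matrix.PosSemidef.one
  have hp : 0 < c + 1 := by linarith
  refine ⟨l / (c + 1), by positivity, ?_⟩
  have h2 := h1.smul (show 0 ≤ l / (c + 1) by positivity)
  rwa [smul_add, smul_smul, div_mul_cancel₀ _ hp.ne'] at h2

def hsForm : LinearMap.BilinForm ℝ (Matrix α α ℂ) :=
  LinearMap.mk₂ ℝ (fun A B => (Aᴴ * B).trace.re)
    (by intros; simp [add_mul]) (by intros; simp) (by intros; simp [mul_add]) (by intros; simp)

lemma hsForm_apply (A B : Matrix α α ℂ) : hsForm A B = (Aᴴ * B).trace.re := rfl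

lemma hsForm_symm (A B : Matrix α α ℂ) : hsForm A B = hsForm B A := by
  rw [hsForm_apply, hsForm_apply, ← Complex.conj_re]
  change (star (Aᴴ * B).trace).re = _
  rw [← Matrix.trace_conjTranspose]; simp

lemma hsForm_self {A : Matrix α α ℂ} (h : hsForm A A = 0) : A = 0 := by
  rw [hsForm_apply] at h
  have h1 : (Aᴴ * A).trace = (((Aᴴ * A).trace.re : ℝ) : ℂ) := by
    have : star (Aᴴ * A).trace = (Aᴴ * A).trace := by
      rw [← Matrix.trace_conjTranspose]; simp
    exact (Complex.conj_eq_iff_re.mp this).symm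
  rw [h] at h1
  exact Matrix.trace_conjTranspose_mul_self_eq_zero_iff.mp (by simpa using h1)

lemma decomp (V : Submodule ℝ (Matrix α α ℂ)) (hV : ∀ T ∈ V, T.IsHermitian)
    {A : Matrix α α ℂ} (hA : A.IsHermitian) :
    ∃ p ∈ V, ∃ q : Matrix α α ℂ, q.IsHermitian ∧ (∀ X ∈ V, (X * q).trace = 0) ∧ A = p + q := by
  have hc : IsCompl V (hsForm.orthogonal V) := by
    rw [LinearMap.BilinForm.isCompl_orthogonal_iff_disjoint
      (fun x y h => by rw [hsForm_symm]; exact h)]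
    rw [Submodule.disjoint_def]
    intro x hx hx'
    exact hsForm_self (hx' x hx)
  have : A ∈ V ⊔ hsForm.orthogonal V := by rw [hc.sup_eq_top]; trivial
  obtain ⟨p, hp, q, hq, rfl⟩ := Submodule.mem_sup.mp this
  have hqh : q.IsHermitian := by
    have := hA.sub (hV p hp)
    simpa using this
  refine ⟨p, hp, q, hqh, ?_, rfl⟩
  intro X hX
  have h0 : (Xᴴ * q).trace.re = 0 := hq X hX
  rw [(hV X hX).eq] at h0
  rw [trace_real (hV X hX) hqh, h0]; simp

def herm (α : Type) : Submodule ℝ (Matrix α α ℂ) := selfAdjoint.submodule ℝ (Matrix α α ℂ)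

lemma mem_herm {A : Matrix α α ℂ} : A ∈ herm α ↔ A.IsHermitian := Iff.rfl

lemma kron_real (A : Matrix α α ℂ) (B : Matrix β β ℂ) :
    A ⊗ₖ B + (A ⊗ₖ B)ᴴ ∈ tensSpan (herm α : Set (Matrix α α ℂ)) (herm β : Set (Matrix β β ℂ)) := by
  have e : A ⊗ₖ B + (A ⊗ₖ B)ᴴ = (1/2 : ℝ) • ((A + Aᴴ) ⊗ₖ (B + Bᴴ)) +
      (1/2 : ℝ) • ((Complex.I • (A - Aᴴ)) ⊗ₖ ((-Complex.I) • (B - Bᴴ))) := by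
    ext ⟨a, b⟩ ⟨c, d⟩
    simp [Matrix.kroneckerMap_apply]
    ring_nf
    simp
    ring
  rw [e]
  refine add_mem (Submodule.smul_mem _ _ (Submodule.subset_span ⟨_, ?_, _, ?_, rfl⟩))
    (Submodule.smul_mem _ _ (Submodule.subset_span ⟨_, ?_, _, ?_, rfl⟩)) <;>
  · change Matrix.IsHermitian _
    ext i j
    simp
    ring

lemma herm_span {S : Matrix (α × β) (α × β) ℂ} (hS : S.IsHermitian) :
    S ∈ tensSpan (herm α : Set (Matrix α α ℂ)) (herm β : Set (Matrix β β ℂ)) := by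
  have e : S = ∑ a, ∑ b, ∑ c, ∑ d, (S (a, b) (c, d) • Matrix.single a c (1 : ℂ)) ⊗ₖ
      Matrix.single b d (1 : ℂ) := by
    ext ⟨a, b⟩ ⟨c, d⟩
    simp [Matrix.sum_apply, Matrix.single_apply, Finset.sum_ite_eq, ite_and]
  have e2 : S = (1/2 : ℝ) • (S + Sᴴ) := by
    rw [hS.eq]; ext i j; simp; ring
  rw [e2]
  refine Submodule.smul_mem _ _ ?_
  rw [e]
  simp only [Matrix.conjTranspose_sum, ← Finset.sum_add_distrib]
  exact sum_mem fun a _ => sum_mem fun b _ => sum_mem fun c _ => sum_mem fun d _ => kron_real _ _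

lemma Lmap_zero {S : Matrix (α × β) (α × β) ℂ}
    (h : ∀ X : Matrix α α ℂ, X.IsHermitian → Lmap X S = 0) : S = 0 := by
  have h2 : ∀ X : Matrix α α ℂ, Lmap X S = 0 := by
    intro X
    have e1 := h (X + Xᴴ) (by ext i j; simp; ring)
    have e2 := h (Complex.I • (X - Xᴴ)) (by ext i j; simp; ring)
    ext b d
    have e1 := congrFun (congrFun e1 b) d
    have e2 := congrFun (congrFun e2 b) d
    simp only [Lmap_apply, ptr_entry, Matrix.add_apply, Matrix.sub_apply, Matrix.smul_apply,
      smul_eq_mul, add_mul, sub_mul, mul_assoc, Finset.sum_add_distrib, Finset.sum_sub_distrib,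
      ← Finset.mul_sum, Matrix.zero_apply] at *
    have e2 := (mul_eq_zero.mp e2).resolve_left Complex.I_ne_zero
    linear_combination (e1 + e2) / 2
  ext ⟨a, b⟩ ⟨c, d⟩
  have := congrFun (congrFun (h2 (Matrix.single c a 1)) b) d
  simpa [Lmap_apply, ptr_entry, Matrix.single_apply, ite_and] using this

def good (Δx : Submodule ℝ (Matrix α α ℂ)) (Δy : Submodule ℝ (Matrix β β ℂ)) :
    Submodule ℝ (Matrix (α × β) (α × β) ℂ) :=
  tensSpan (hermComp Δx) (gammaSet β) ⊔ tensSpan (gammaSet α) (Δy : Set _) ⊔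
           tensSpan (hermComp Δx) (Δy : Set _) ⊔ tensSpan (Δx : Set _) (Δy : Set _) ⊔
           tensSpan (hermComp Δx) (hermComp Δy)

lemma V_herm {Δ : Submodule ℝ (Matrix α α ℂ)} (hΔ : ∀ T ∈ Δ, T.IsHermitian) :
    ∀ T ∈ (Submodule.span ℝ {(1 : Matrix α α ℂ)} ⊔ Δ : Submodule ℝ (Matrix α α ℂ)),
      T.IsHermitian := by
  have : (Submodule.span ℝ {(1 : Matrix α α ℂ)} ⊔ Δ : Submodule ℝ (Matrix α α ℂ)) ≤ herm α := by
    refine sup_le ?_ hΔ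
    rw [Submodule.span_le, Set.singleton_subset_iff]
    exact Matrix.isHermitian_one
  exact this

lemma tens_map {V : Set (Matrix α α ℂ)} {W : Set (Matrix β β ℂ)} {N : Submodule ℝ (Matrix β β ℂ)}
    {X : Matrix α α ℂ} (h : ∀ A ∈ V, ∀ B ∈ W, (X * A).trace • B ∈ N) :
    tensSpan V W ≤ N.comap (Lmap X) := by
  rw [tensSpan, Submodule.span_le]
  rintro _ ⟨A, hA, B, hB, rfl⟩
  change Lmap X (A ⊗ₖ B) ∈ N
  rw [Lmap_kron]
  exact h A hA B hB

lemma real_smul_mem {N : Submodule ℝ (Matrix β β ℂ)} {X A : Matrix α α ℂ} {B : Matrix β β ℂ}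
    (hX : X.IsHermitian) (hA : A.IsHermitian) (hB : B ∈ N) : (X * A).trace • B ∈ N := by
  rw [trace_real hX hA, Complex.coe_smul]
  exact N.smul_mem _ hB

lemma good_map {Δx : Submodule ℝ (Matrix α α ℂ)} {Δy : Submodule ℝ (Matrix β β ℂ)}
    (hΔx : ∀ T ∈ Δx, T.IsHermitian) {X : Matrix α α ℂ}
    (hX : X ∈ (Submodule.span ℝ {(1 : Matrix α α ℂ)} ⊔ Δx : Submodule ℝ (Matrix α α ℂ)))
    {S : Matrix (α × β) (α × β) ℂ} (hS : S ∈ good Δx Δy) : Lmap X S ∈ Δy := by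
  have hXh := V_herm hΔx X hX
  have key : good Δx Δy ≤ Δy.comap (Lmap X) := by
    refine sup_le (sup_le (sup_le (sup_le ?_ ?_) ?_) ?_) ?_
    · refine tens_map fun A hA B _ => ?_
      rw [hA.2 X hX, zero_smul]; exact Δy.zero_mem
    · exact tens_map fun A hA B hB =>
        real_smul_mem hXh (V_herm hΔx A (Submodule.mem_sup_left hA)) hB
    · exact tens_map fun A hA B hB => real_smul_mem hXh hA.1 hB
    · exact tens_map fun A hA B hB => real_smul_mem hXh (hΔx A hA) hB
    · refine tens_map fun A hA B _ => ?_
      rw [hA.2 X hX, zero_smul]; exact Δy.zero_mem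
  exact key hS

def perp (Δ : Submodule ℝ (Matrix β β ℂ)) : Submodule ℝ (Matrix β β ℂ) where
  carrier := {B | ∀ X ∈ Δ, (X * B).trace = 0}
  add_mem' := by
    intro a b ha hb X hX
    rw [mul_add, Matrix.trace_add, ha X hX, hb X hX, add_zero]
  zero_mem' := by intro X _; simp
  smul_mem' := by
    intro c a ha X hX
    rw [mul_smul_comm, Matrix.trace_smul, ha X hX, smul_zero]

lemma tens_mem {V : Set (Matrix α α ℂ)} {W : Set (Matrix β β ℂ)} {A : Matrix α α ℂ}
    {B : Matrix β β ℂ} (hA : A ∈ V) (hB : B ∈ W) : A ⊗ₖ B ∈ tensSpan V W :=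
  Submodule.subset_span ⟨A, hA, B, hB, rfl⟩

lemma split {Δx : Submodule ℝ (Matrix α α ℂ)} {Δy : Submodule ℝ (Matrix β β ℂ)}
    (hΔx : ∀ T ∈ Δx, T.IsHermitian) (hΔy : ∀ T ∈ Δy, T.IsHermitian) :
    tensSpan (herm α : Set (Matrix α α ℂ)) (herm β : Set (Matrix β β ℂ)) ≤
      good Δx Δy ⊔ tensSpan
        ((Submodule.span ℝ {(1 : Matrix α α ℂ)} ⊔ Δx : Submodule ℝ (Matrix α α ℂ)) : Set _)
        (perp Δy : Set (Matrix β β ℂ)) := by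
  rw [tensSpan, Submodule.span_le]
  rintro _ ⟨A, hA, B, hB, rfl⟩
  obtain ⟨p, hp, q, hqh, hq, rfl⟩ := decomp _ (V_herm hΔx) hA
  have hqc : q ∈ hermComp Δx := ⟨hqh, hq⟩
  change (p + q) ⊗ₖ B ∈ _
  rw [Matrix.add_kronecker]
  refine add_mem ?_ (Submodule.mem_sup_left ?_)
  · obtain ⟨b, hb, b', _, hb', rfl⟩ := decomp _ hΔy hB
    rw [Matrix.kronecker_add]
    refine add_mem (Submodule.mem_sup_left ?_) (Submodule.mem_sup_right (tens_mem hp hb'))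
    obtain ⟨r, hr, t, ht, rfl⟩ := Submodule.mem_sup.mp hp
    rw [Matrix.add_kronecker]
    have h1 := tens_mem (V := gammaSet α) (W := (Δy : Set (Matrix β β ℂ))) hr hb
    have h2 := tens_mem (V := (Δx : Set (Matrix α α ℂ))) (W := (Δy : Set (Matrix β β ℂ))) ht hb
    exact add_mem (Submodule.mem_sup_left (Submodule.mem_sup_left (Submodule.mem_sup_left
      (Submodule.mem_sup_right h1)))) (Submodule.mem_sup_left (Submodule.mem_sup_right h2))
  · obtain ⟨b, hb, b', hbh, hb', rfl⟩ := decomp _ (V_herm hΔy) hB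
    obtain ⟨r, hr, t, ht, rfl⟩ := Submodule.mem_sup.mp hb
    rw [Matrix.kronecker_add, Matrix.kronecker_add]
    have h1 := tens_mem (W := gammaSet β) hqc hr
    have h2 := tens_mem (W := (Δy : Set (Matrix β β ℂ))) hqc ht
    have h3 := tens_mem (W := hermComp Δy) hqc ⟨hbh, hb'⟩
    exact add_mem (add_mem (Submodule.mem_sup_left (Submodule.mem_sup_left (Submodule.mem_sup_left
      (Submodule.mem_sup_left h1)))) (Submodule.mem_sup_left (Submodule.mem_sup_left
      (Submodule.mem_sup_right h2)))) (Submodule.mem_sup_right h3)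

lemma mem_good {Δx : Submodule ℝ (Matrix α α ℂ)} {Δy : Submodule ℝ (Matrix β β ℂ)}
    (hΔx : ∀ T ∈ Δx, T.IsHermitian) (hΔy : ∀ T ∈ Δy, T.IsHermitian)
    {S : Matrix (α × β) (α × β) ℂ} (hS : S.IsHermitian)
    (h : ∀ X ∈ (Submodule.span ℝ {(1 : Matrix α α ℂ)} ⊔ Δx : Submodule ℝ (Matrix α α ℂ)),
      Lmap X S ∈ Δy) : S ∈ good Δx Δy := by
  obtain ⟨g, hg, s, hs, rfl⟩ := Submodule.mem_sup.mp (split hΔx hΔy (herm_span hS))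
  have hs0 : s = 0 := by
    apply Lmap_zero
    intro X hX
    obtain ⟨p, hp, q, hqh, hq, rfl⟩ := decomp _ (V_herm hΔx) hX
    rw [map_add, LinearMap.add_apply]
    have h1 : Lmap p s ∈ Δy := by
      have h2 := sub_mem (h p hp) (good_map hΔx hp hg)
      rwa [map_add, add_sub_cancel_left] at h2
    have h2 : Lmap p s ∈ perp Δy :=
      tens_map (N := perp Δy) (fun A hA B hB =>
        real_smul_mem (V_herm hΔx p hp) (V_herm hΔx A hA) hB) hs
    have h3 : Lmap q s ∈ (⊥ : Submodule ℝ (Matrix β β ℂ)) :=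
      tens_map (N := ⊥) (fun A hA B hB => by
        rw [Matrix.trace_mul_comm, hq A hA, zero_smul]; exact Submodule.zero_mem _) hs
    rw [(Submodule.mem_bot ℝ).mp h3, add_zero]
    apply hsForm_self
    rw [hsForm_apply, (hΔy _ h1).eq, h2 _ h1, Complex.zero_re]
  rw [hs0, add_zero]
  exact hg

lemma Lmap_one (c : ℝ) (X : Matrix α α ℂ) :
    Lmap X (c • (1 : Matrix (α × β) (α × β) ℂ)) = (c * X.trace) • (1 : Matrix β β ℂ) := by
  rw [map_smul, ← Matrix.one_kronecker_one, Lmap_kron, mul_one, mul_smul, Complex.coe_smul]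

lemma Lmap_det [Nonempty α] {lamx lamy : ℝ} (hlamx : 0 < lamx)
    {Δx : Submodule ℝ (Matrix α α ℂ)}
    (hΔx : ∀ T ∈ Δx, T.IsHermitian ∧ T.trace = 0) {X : Matrix α α ℂ}
    (hX : X - lamx • (1 : Matrix α α ℂ) ∈ Δx) :
    Lmap X ((lamy / (lamx * (Fintype.card α : ℝ))) • (1 : Matrix (α × β) (α × β) ℂ)) =
      lamy • (1 : Matrix β β ℂ) := by
  have ht : X.trace = ((lamx * (Fintype.card α : ℝ) : ℝ) : ℂ) := by
    have := (hΔx _ hX).2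
    rw [Matrix.trace_sub, Matrix.trace_smul, Matrix.trace_one, sub_eq_zero] at this
    rw [this]; simp
  have hc : lamx * (Fintype.card α : ℝ) ≠ 0 :=
    mul_ne_zero hlamx.ne' (Nat.cast_ne_zero.mpr Fintype.card_ne_zero)
  rw [Lmap_one, ht, ← Complex.ofReal_mul, div_mul_cancel₀ _ hc, Complex.coe_smul]

lemma memV {l : ℝ} {Δx : Submodule ℝ (Matrix α α ℂ)} {X : Matrix α α ℂ}
    (hX : X - l • (1 : Matrix α α ℂ) ∈ Δx) :
    X ∈ (Submodule.span ℝ {(1 : Matrix α α ℂ)} ⊔ Δx : Submodule ℝ (Matrix α α ℂ)) := by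
  have := add_mem (Submodule.mem_sup_right (S := Submodule.span ℝ {(1 : Matrix α α ℂ)}) hX)
    (Submodule.mem_sup_left (Submodule.smul_mem _ l (Submodule.mem_span_singleton_self 1)))
  simpa using this

lemma backward [Nonempty α] {lamx lamy : ℝ} (hlamx : 0 < lamx)
    {Δx : Submodule ℝ (Matrix α α ℂ)} {Δy : Submodule ℝ (Matrix β β ℂ)}
    (hΔx : ∀ T ∈ Δx, T.IsHermitian ∧ T.trace = 0)
    {R : Matrix (α × β) (α × β) ℂ} (hR : R.PosSemidef)
    (h : R - (lamy / (lamx * (Fintype.card α : ℝ))) • (1 : Matrix (α × β) (α × β) ℂ) ∈ good Δx Δy) :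
    ∀ X ∈ detSet lamx (Δx : Set (Matrix α α ℂ)),
          ptrLeft ((X ⊗ₖ (1 : Matrix β β ℂ)) * R) ∈
            detSet lamy (Δy : Set (Matrix β β ℂ)) := by
  rintro X ⟨hXp, hX⟩
  refine ⟨ptr_posSemidef hXp hR, ?_⟩
  have h1 := good_map (fun T hT => (hΔx T hT).1) (memV hX) h
  rw [map_sub, Lmap_det hlamx hΔx hX] at h1
  exact h1

lemma forward [Nonempty α] {lamx lamy : ℝ} (hlamx : 0 < lamx)
    {Δx : Submodule ℝ (Matrix α α ℂ)} {Δy : Submodule ℝ (Matrix β β ℂ)}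
    (hΔx : ∀ T ∈ Δx, T.IsHermitian ∧ T.trace = 0)
    (hΔy : ∀ T ∈ Δy, T.IsHermitian ∧ T.trace = 0)
    {R : Matrix (α × β) (α × β) ℂ} (hR : R.PosSemidef)
    (h : ∀ X ∈ detSet lamx (Δx : Set (Matrix α α ℂ)),
          ptrLeft ((X ⊗ₖ (1 : Matrix β β ℂ)) * R) ∈
            detSet lamy (Δy : Set (Matrix β β ℂ))) :
    R - (lamy / (lamx * (Fintype.card α : ℝ))) • (1 : Matrix (α × β) (α × β) ℂ) ∈ good Δx Δy := by
  refine mem_good (fun T hT => (hΔx T hT).1) (fun T hT => (hΔy T hT).1) ?_ ?_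
  · refine hR.1.sub ?_
    ext i j
    by_cases hij : i = j <;> simp [Matrix.one_apply, hij, eq_comm]
  set S := R - (lamy / (lamx * (Fintype.card α : ℝ))) • (1 : Matrix (α × β) (α × β) ℂ) with hS
  have key : ∀ X ∈ detSet lamx (Δx : Set (Matrix α α ℂ)), Lmap X S ∈ Δy := by
    intro X hX
    rw [hS, map_sub, Lmap_det hlamx hΔx hX.2]
    exact (h X hX).2
  have k1 : Lmap (lamx • (1 : Matrix α α ℂ)) S ∈ Δy := by
    refine key _ ⟨Matrix.PosSemidef.one.smul hlamx.le, ?_⟩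
    rw [sub_self]; exact Δx.zero_mem
  have hle : (Submodule.span ℝ {(1 : Matrix α α ℂ)} ⊔ Δx : Submodule ℝ (Matrix α α ℂ)) ≤
      Δy.comap (Lmap.flip S) := by
    refine sup_le ?_ ?_
    · rw [Submodule.span_le, Set.singleton_subset_iff]
      change Lmap 1 S ∈ Δy
      rw [map_smul, LinearMap.smul_apply] at k1
      exact (Submodule.smul_mem_iff _ hlamx.ne').mp k1
    · intro T hT
      change Lmap T S ∈ Δy
      obtain ⟨e, he, hp⟩ := exists_psd hlamx (hΔx T hT).1
      have k2 := key _ ⟨hp, by rw [add_sub_cancel_left]; exact Δx.smul_mem e hT⟩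
      rw [map_add, LinearMap.add_apply] at k2
      have k3 := (Submodule.add_mem_iff_right _ k1).mp k2
      rw [map_smul, LinearMap.smul_apply] at k3
      exact (Submodule.smul_mem_iff _ he.ne').mp k3
  exact fun X hX => hle hX

end helpers

/-- characterisation of the deterministic maps of type `x → y`:
`D(x→y) = {R PSD | R − (λ_y/(λ_x·dim H_x))·I ∈ Δ_{x→y}}` with
`Δ_{x→y} = (Δ̄_x⊗Γ_y) + (Γ_x⊗Δ_y) + (Δ̄_x⊗Δ_y) + (Δ_x⊗Δ_y) + (Δ̄_x⊗Δ̄_y)`; in particular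
`(λ_y/(λ_x·dim H_x))·I ∈ D(x→y)`. -/
theorem stmt_6 {ιx ιy : Type} [Fintype ιx] [DecidableEq ιx] [Nonempty ιx]
    [Fintype ιy] [DecidableEq ιy] [Nonempty ιy]
    (lamx lamy : ℝ) (hlamx : 0 < lamx) (hlamy : 0 < lamy)
    (Δx : Submodule ℝ (Matrix ιx ιx ℂ)) (Δy : Submodule ℝ (Matrix ιy ιy ℂ))
    (hΔx : ∀ T ∈ Δx, T.IsHermitian ∧ T.trace = 0)
    (hΔy : ∀ T ∈ Δy, T.IsHermitian ∧ T.trace = 0) :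
    {R : Matrix (ιx × ιy) (ιx × ιy) ℂ | R.PosSemidef ∧
        ∀ X ∈ detSet lamx (Δx : Set (Matrix ιx ιx ℂ)),
          ptrLeft ((X ⊗ₖ (1 : Matrix ιy ιy ℂ)) * R) ∈
            detSet lamy (Δy : Set (Matrix ιy ιy ℂ))} =
      {R : Matrix (ιx × ιy) (ιx × ιy) ℂ | R.PosSemidef ∧
        R - (lamy / (lamx * (Fintype.card ιx : ℝ))) • (1 : Matrix (ιx × ιy) (ιx × ιy) ℂ) ∈
          (tensSpan (hermComp Δx) (gammaSet ιy) ⊔ tensSpan (gammaSet ιx) (Δy : Set _) ⊔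
           tensSpan (hermComp Δx) (Δy : Set _) ⊔ tensSpan (Δx : Set _) (Δy : Set _) ⊔
           tensSpan (hermComp Δx) (hermComp Δy) :
             Submodule ℝ (Matrix (ιx × ιy) (ιx × ιy) ℂ))} ∧
    (lamy / (lamx * (Fintype.card ιx : ℝ))) • (1 : Matrix (ιx × ιy) (ιx × ιy) ℂ) ∈
      {R : Matrix (ιx × ιy) (ιx × ιy) ℂ | R.PosSemidef ∧
        ∀ X ∈ detSet lamx (Δx : Set (Matrix ιx ιx ℂ)),
          ptrLeft ((X ⊗ₖ (1 : Matrix ιy ιy ℂ)) * R) ∈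
            detSet lamy (Δy : Set (Matrix ιy ιy ℂ))} := by
  refine ⟨Set.ext fun R => ⟨?_, ?_⟩, ?_, ?_⟩
  · rintro ⟨hR, h⟩
    exact ⟨hR, forward hlamx hΔx hΔy hR h⟩
  · rintro ⟨hR, h⟩
    exact ⟨hR, backward hlamx hΔx hR h⟩
  · exact Matrix.PosSemidef.one.smul (by positivity)
  · refine backward hlamx hΔx (Matrix.PosSemidef.one.smul (by positivity)) ?_
    rw [sub_self]
    exact Submodule.zero_mem _

end
end

section
/- Let (λ, Δ) be a type datum on H with deterministic set D := D(λ,Δ), and define D̄ := { Y : Y is PSD on H and Tr[XY] = 1 for every X ∈ D }. Then a PSD operator X on H belongs to D if and only if Tr[XY] = 1 for every Y ∈ D̄. -/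
open Matrix Kronecker ComplexOrder

noncomputable section

def trB {ι : Type} [Fintype ι] : LinearMap.BilinForm ℝ (Matrix ι ι ℂ) :=
  LinearMap.mk₂ ℝ (fun A C => ((A * C).trace).re)
    (fun A B C => by simp [add_mul]) (fun r A C => by simp)
    (fun A B C => by simp [mul_add]) (fun r A C => by simp)

lemma trB_apply {ι : Type} [Fintype ι] (A C : Matrix ι ι ℂ) :
    trB A C = ((A * C).trace).re := rfl

lemma herm_zero {ι : Type} [Fintype ι] {A : Matrix ι ι ℂ} (hA : A.IsHermitian)
    (h : (A * A).trace = 0) : A = 0 := by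
  apply Matrix.trace_mul_conjTranspose_self_eq_zero_iff.1
  rwa [hA.eq]

lemma herm_tr_im {ι : Type} [Fintype ι] {A C : Matrix ι ι ℂ} (hA : A.IsHermitian)
    (hC : C.IsHermitian) : ((A * C).trace).im = 0 := by
  have h : star (A * C).trace = (A * C).trace := by
    rw [← Matrix.trace_conjTranspose, Matrix.conjTranspose_mul, hA.eq, hC.eq, Matrix.trace_mul_comm]
  exact Complex.conj_eq_iff_im.1 h

lemma herm_tr_zero {ι : Type} [Fintype ι] {A C : Matrix ι ι ℂ} (hA : A.IsHermitian)
    (hC : C.IsHermitian) (h : trB A C = 0) : (A * C).trace = 0 :=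
  Complex.ext h (herm_tr_im hA hC)

lemma exists_proj {ι : Type} [Fintype ι] (Δ : Submodule ℝ (Matrix ι ι ℂ))
    (hΔ : ∀ T ∈ Δ, T.IsHermitian) (T : Matrix ι ι ℂ) :
    ∃ P ∈ Δ, ∀ S ∈ Δ, trB S (T - P) = 0 := by
  have hr : (trB (ι := ι)).IsRefl := by
    intro A C h
    rw [trB_apply] at h ⊢
    rwa [Matrix.trace_mul_comm]
  have hd : Disjoint Δ (trB.orthogonal Δ) := by
    rw [Submodule.disjoint_def]
    intro A hA hA'
    exact herm_zero (hΔ A hA) (herm_tr_zero (hΔ A hA) (hΔ A hA) (hA' A hA))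
  have hc := LinearMap.BilinForm.isCompl_orthogonal_of_restrict_nondegenerate hr
    (trB.nondegenerate_restrict_of_disjoint_orthogonal hr hd)
  have ht : T ∈ Δ ⊔ trB.orthogonal Δ := by rw [hc.sup_eq_top]; trivial
  obtain ⟨P, hP, Q, hQ, rfl⟩ := Submodule.mem_sup.1 ht
  refine ⟨P, hP, fun S hS => ?_⟩
  rw [add_sub_cancel_left]
  exact hQ S hS

open scoped MatrixOrder Matrix.Norms.L2Operator in
lemma exists_bound {ι : Type} [Fintype ι] [DecidableEq ι] {W : Matrix ι ι ℂ}
    (hW : W.IsHermitian) : ∃ c : ℝ, 0 < c ∧ (c • (1 : Matrix ι ι ℂ) + W).PosSemidef := by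
  have h1 : -(algebraMap ℝ (Matrix ι ι ℂ) ‖W‖) ≤ W :=
    IsSelfAdjoint.neg_algebraMap_norm_le_self (a := W) hW
  refine ⟨‖W‖ + 1, by positivity, ?_⟩
  have h2 := (Matrix.le_iff.1 h1).add (Matrix.PosSemidef.one (n := ι) (R := ℂ))
  have h3 : (‖W‖ + 1) • (1 : Matrix ι ι ℂ) + W
      = W - -(algebraMap ℝ (Matrix ι ι ℂ) ‖W‖) + 1 := by
    rw [Algebra.algebraMap_eq_smul_one, add_smul, one_smul]
    abel
  rw [h3]
  exact h2

/-- let `(λ,Δ)` be a type datum on `H` with deterministic set `D`, and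
`D̄ := {Y PSD | Tr[XY] = 1 for all X ∈ D}`. Then a PSD operator `X` belongs to `D` iff
`Tr[XY] = 1` for every `Y ∈ D̄`. -/
theorem stmt_7 {ι : Type} [Fintype ι] [DecidableEq ι] [Nonempty ι]
    (lam : ℝ) (hlam : 0 < lam) (Δ : Submodule ℝ (Matrix ι ι ℂ))
    (hΔ : ∀ T ∈ Δ, T.IsHermitian ∧ T.trace = 0)
    (X : Matrix ι ι ℂ) (hX : X.PosSemidef) :
    X ∈ detSet lam (Δ : Set (Matrix ι ι ℂ)) ↔
      ∀ Y ∈ {Y : Matrix ι ι ℂ | Y.PosSemidef ∧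
              ∀ Z ∈ detSet lam (Δ : Set (Matrix ι ι ℂ)), (Z * Y).trace = 1},
        (X * Y).trace = 1 := by
  constructor
  · rintro h Y ⟨-, hY⟩
    exact hY X h
  intro h
  have hd : (0 : ℝ) < Fintype.card ι := by exact_mod_cast Fintype.card_pos
  have hdc : (Fintype.card ι : ℂ) ≠ 0 := by exact_mod_cast hd.ne'
  have hlc : (lam : ℂ) ≠ 0 := by exact_mod_cast hlam.ne'
  set a : ℝ := (lam * Fintype.card ι)⁻¹ with ha
  have ha0 : 0 < a := by positivity
  have hac : (a : ℂ) * (lam * Fintype.card ι) = 1 := by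
    rw [ha]; push_cast; field_simp
  have htr : ∀ Z ∈ detSet lam (Δ : Set (Matrix ι ι ℂ)), Z.trace = lam * Fintype.card ι := by
    rintro Z ⟨-, hZ⟩
    have := (hΔ _ hZ).2
    rw [Matrix.trace_sub, Matrix.trace_smul, Matrix.trace_one, sub_eq_zero] at this
    rw [this, Complex.real_smul]
  have psd1 : ∀ r : ℝ, 0 ≤ r → (r • (1 : Matrix ι ι ℂ)).PosSemidef := fun r hr =>
    Matrix.PosSemidef.one.smul hr
  have hXt : (a : ℂ) * X.trace = 1 := by
    have := h (a • 1) ⟨psd1 a ha0.le, fun Z hZ => by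
      rw [Matrix.mul_smul, mul_one, Matrix.trace_smul, htr Z hZ, Complex.real_smul, hac]⟩
    rwa [Matrix.mul_smul, mul_one, Matrix.trace_smul, Complex.real_smul] at this
  have hac0 : (a : ℂ) ≠ 0 := by exact_mod_cast ha0.ne'
  have hXt' : X.trace = lam * Fintype.card ι := mul_left_cancel₀ hac0 (hXt.trans hac.symm)
  refine ⟨hX, ?_⟩
  have h1H : (lam • (1 : Matrix ι ι ℂ)).IsHermitian := (psd1 lam hlam.le).1
  set T := X - lam • (1 : Matrix ι ι ℂ) with hT
  have hTH : T.IsHermitian := hX.1.sub h1H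
  have hTt : T.trace = 0 := by
    rw [hT, Matrix.trace_sub, Matrix.trace_smul, Matrix.trace_one, hXt', Complex.real_smul, sub_self]
  obtain ⟨P, hP, horth⟩ := exists_proj Δ (fun T hT => (hΔ T hT).1) T
  have hWH : (T - P).IsHermitian := hTH.sub (hΔ P hP).1
  have hWt : (T - P).trace = 0 := by rw [Matrix.trace_sub, hTt, (hΔ P hP).2, sub_self]
  have horth' : ∀ S ∈ Δ, (S * (T - P)).trace = 0 := fun S hS =>
    herm_tr_zero (hΔ S hS).1 hWH (horth S hS)
  generalize hWd : T - P = W at *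
  obtain ⟨c, hc, hpsd⟩ := exists_bound hWH
  have hcc : (c : ℂ) ≠ 0 := by exact_mod_cast hc.ne'
  have key : ∀ Z : Matrix ι ι ℂ, Z.trace = lam * Fintype.card ι →
      (Z * ((a / c) • (c • (1 : Matrix ι ι ℂ) + W))).trace
        = 1 + (a / c : ℂ) * ((Z - lam • (1 : Matrix ι ι ℂ)) * W).trace := by
    intro Z hZ
    rw [Matrix.mul_smul, mul_add, Matrix.mul_smul, mul_one, sub_mul, Matrix.smul_mul, one_mul]
    simp only [Matrix.trace_smul, Matrix.trace_add, Matrix.trace_sub, hWt, hZ, Complex.real_smul]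
    rw [mul_add, ← hac]
    push_cast
    field_simp
    ring
  have hY := h ((a / c) • (c • (1 : Matrix ι ι ℂ) + W))
    ⟨hpsd.smul (by positivity), fun Z hZ => by
      rw [key Z (htr Z hZ), horth' _ hZ.2, mul_zero, add_zero]⟩
  rw [key X hXt', ← hT] at hY
  have hTW : (T * W).trace = 0 := by
    have : (a / c : ℂ) ≠ 0 := div_ne_zero hac0 hcc
    simpa [this, hac0, hcc] using hY
  have hWW : (W * W).trace = 0 := by
    nth_rw 1 [← hWd]
    rw [sub_mul, Matrix.trace_sub, hTW, horth' P hP, sub_self]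
  have hW0 := herm_zero hWH hWW
  rw [hW0, sub_eq_zero] at hWd
  rw [SetLike.mem_coe, hWd]
  exact hP

end
end

section
/- Let (λ, Δ) be a type datum on H with deterministic set D := D(λ,Δ), and define D̄ := { Y : Y is PSD on H and Tr[XY] = 1 for every X ∈ D }. Then D̄ is the deterministic set of the dual datum, i.e. D̄ = { Y : Y PSD on H and Y − (1/(λ·dim H))·I ∈ Δ̄ }. -/
open Matrix Kronecker ComplexOrder

noncomputable section

section Aux
open scoped Matrix.Norms.L2Operator MatrixOrder

theorem exists_shift_posSemidef {ι : Type} [Fintype ι] [DecidableEq ι]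
    (T : Matrix ι ι ℂ) (hT : T.IsHermitian) :
    ∃ M : ℝ, 0 < M ∧ (M • (1 : Matrix ι ι ℂ) + T).PosSemidef := by
  refine ⟨‖T‖ + 1, by positivity, ?_⟩
  have h1 : IsSelfAdjoint T := hT
  have h := h1.neg_algebraMap_norm_le_self
  rw [Matrix.le_iff, sub_neg_eq_add, Algebra.algebraMap_eq_smul_one] at h
  have h2 : (1 : Matrix ι ι ℂ).PosSemidef := Matrix.PosSemidef.one
  have h3 := h.add h2
  have e : (‖T‖ + 1) • (1 : Matrix ι ι ℂ) + T = T + ‖T‖ • (1 : Matrix ι ι ℂ) + 1 := by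
    rw [add_smul, one_smul]
    abel
  rw [e]
  exact h3

end Aux

/-- let `(λ,Δ)` be a type datum on `H` with deterministic set `D`, and
`D̄ := {Y PSD | Tr[XY] = 1 for all X ∈ D}`.  Then `D̄` is the deterministic set of the dual
datum `(1/(λ·dim H), Δ̄)`. -/
theorem stmt_8 {ι : Type} [Fintype ι] [DecidableEq ι] [Nonempty ι]
    (lam : ℝ) (hlam : 0 < lam) (Δ : Submodule ℝ (Matrix ι ι ℂ))
    (hΔ : ∀ T ∈ Δ, T.IsHermitian ∧ T.trace = 0) :
    {Y : Matrix ι ι ℂ | Y.PosSemidef ∧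
        ∀ X ∈ detSet lam (Δ : Set (Matrix ι ι ℂ)), (X * Y).trace = 1} =
      detSet (1 / (lam * (Fintype.card ι : ℝ))) (hermComp Δ) := by
  have hn : (Fintype.card ι : ℝ) ≠ 0 := by exact_mod_cast Fintype.card_ne_zero
  have hnC : (Fintype.card ι : ℂ) ≠ 0 := by exact_mod_cast Fintype.card_ne_zero
  have hlC : (lam : ℂ) ≠ 0 := by exact_mod_cast hlam.ne'
  have h1H : (1 : Matrix ι ι ℂ).IsHermitian := Matrix.isHermitian_one
  have hsm : ∀ (c : ℝ) (A : Matrix ι ι ℂ), (c • A).trace = (c : ℂ) * A.trace := by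
    intro c A
    rw [Matrix.trace_smul, Complex.real_smul]
  ext Y
  simp only [detSet, hermComp, Set.mem_ofPred_eq, SetLike.mem_coe]
  constructor
  · rintro ⟨hY, h⟩
    have hlam1 : (lam • (1 : Matrix ι ι ℂ)).PosSemidef :=
      Matrix.PosSemidef.one.smul hlam.le
    have e1 : (lam : ℂ) * Y.trace = 1 := by
      have := h (lam • 1) ⟨hlam1, by simp⟩
      rwa [smul_mul_assoc, one_mul, hsm] at this
    have e2 : ∀ T ∈ Δ, (T * Y).trace = 0 := by
      intro T hT
      obtain ⟨M, hM, hp⟩ := exists_shift_posSemidef T (hΔ T hT).1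
      have hp' := hp.smul (div_pos hlam hM).le
      rw [smul_add, smul_smul, div_mul_cancel₀ _ hM.ne'] at hp'
      have := h _ ⟨hp', by
        rw [add_sub_cancel_left]; exact Δ.smul_mem _ hT⟩
      rw [add_mul, Matrix.trace_add, smul_mul_assoc, one_mul, smul_mul_assoc, hsm, hsm, e1] at this
      have h0 : ((lam / M : ℝ) : ℂ) * (T * Y).trace = 0 := by linear_combination this
      rcases mul_eq_zero.1 h0 with h0 | h0
      · exact absurd (by exact_mod_cast h0) (div_pos hlam hM).ne'
      · exact h0
    refine ⟨hY, ?_, ?_⟩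
    · refine hY.1.sub ?_
      have : ((1 / (lam * (Fintype.card ι : ℝ))) • (1 : Matrix ι ι ℂ)).PosSemidef :=
        Matrix.PosSemidef.one.smul (by positivity)
      exact this.1
    · intro X hX
      obtain ⟨A, hA, T, hT, rfl⟩ := Submodule.mem_sup.1 hX
      obtain ⟨a, rfl⟩ := Submodule.mem_span_singleton.1 hA
      simp only [add_mul, mul_sub, Matrix.trace_add, Matrix.trace_sub, smul_mul_assoc, one_mul,
        mul_smul_comm, mul_one, hsm, e2 T hT, (hΔ T hT).2, Matrix.trace_one]
      push_cast
      field_simp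
      linear_combination (a : ℂ) * (Fintype.card ι : ℂ) * e1
  · rintro ⟨hY, -, h⟩
    refine ⟨hY, ?_⟩
    rintro X ⟨-, hX⟩
    have k1 := h 1 (Submodule.mem_sup_left (Submodule.mem_span_singleton_self _))
    have k2 := h _ (Submodule.mem_sup_right hX)
    have k3 := (hΔ _ hX).2
    simp only [mul_sub, sub_mul, Matrix.trace_sub, smul_mul_assoc, one_mul,
        mul_smul_comm, mul_one, hsm, Matrix.trace_one] at k1 k2 k3
    have hc : ((1 / (lam * (Fintype.card ι : ℝ)) : ℝ) : ℂ) * (lam * (Fintype.card ι : ℂ)) = 1 := by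
      push_cast
      field_simp
    linear_combination k2 + (lam : ℂ) * k1 + ((1 / (lam * (Fintype.card ι : ℝ)) : ℝ) : ℂ) * k3 + hc

end
end

section
/- Let (λ, Δ) be a type datum on H with deterministic set D := D(λ,Δ). Then a Hermitian operator T on H belongs to Δ if and only if there exist a real number c and elements X₁, X₂ ∈ D such that T = c·(X₁ − X₂). -/
open Matrix Kronecker ComplexOrder

noncomputable section

/-- Shift of a Hermitian matrix is PSD. -/
theorem aux_shift {ι : Type} [Fintype ι] [DecidableEq ι]
    (T : Matrix ι ι ℂ) (hT : T.IsHermitian) :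
    ∃ K : ℝ, 0 < K ∧ (K • (1 : Matrix ι ι ℂ) + T).PosSemidef := by
  refine ⟨1 + ∑ i, |hT.eigenvalues i|, by positivity, ?_⟩
  set K : ℝ := 1 + ∑ i, |hT.eigenvalues i| with hK
  have hd : (diagonal (fun i => ((K + hT.eigenvalues i : ℝ) : ℂ))).PosSemidef := by
    rw [posSemidef_diagonal_iff]
    intro i
    have h1 : |hT.eigenvalues i| ≤ ∑ i, |hT.eigenvalues i| :=
      Finset.single_le_sum (f := fun i => |hT.eigenvalues i|)
        (fun _ _ => abs_nonneg _) (Finset.mem_univ i)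
    have h2 := neg_abs_le (hT.eigenvalues i)
    exact_mod_cast (by linarith : 0 ≤ K + hT.eigenvalues i)
  have h := hd.mul_mul_conjTranspose_same (hT.eigenvectorUnitary : Matrix ι ι ℂ)
  convert h using 1
  have hU : (hT.eigenvectorUnitary : Matrix ι ι ℂ) * (hT.eigenvectorUnitary : Matrix ι ι ℂ)ᴴ = 1 :=
    Unitary.mul_star_self_of_mem hT.eigenvectorUnitary.2
  have e : diagonal (fun i => ((K + hT.eigenvalues i : ℝ) : ℂ))
      = K • (1 : Matrix ι ι ℂ) + diagonal (RCLike.ofReal ∘ hT.eigenvalues) := by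
    ext i j
    by_cases hij : i = j
    · subst hij; simp
    · simp [hij]
  rw [e, mul_add, add_mul, mul_smul_comm, mul_one, smul_mul_assoc, hU]
  congr 1
  conv_lhs => rw [hT.spectral_theorem]
  rw [Unitary.conjStarAlgAut_apply]
  rfl

/-- let `(λ,Δ)` be a type datum on `H` with deterministic set `D := D(λ,Δ)`.
A Hermitian operator `T` belongs to `Δ` iff `T = c·(X₁ − X₂)` with `c : ℝ` and
`X₁, X₂ ∈ D`. -/
theorem stmt_9 {ι : Type} [Fintype ι] [DecidableEq ι] [Nonempty ι]
    (lam : ℝ) (hlam : 0 < lam) (Δ : Submodule ℝ (Matrix ι ι ℂ))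
    (hΔ : ∀ T ∈ Δ, T.IsHermitian ∧ T.trace = 0)
    (T : Matrix ι ι ℂ) (hT : T.IsHermitian) :
    T ∈ Δ ↔ ∃ (c : ℝ) (X₁ X₂ : Matrix ι ι ℂ),
      X₁ ∈ detSet lam (Δ : Set (Matrix ι ι ℂ)) ∧
      X₂ ∈ detSet lam (Δ : Set (Matrix ι ι ℂ)) ∧
      T = c • (X₁ - X₂) := by
  constructor
  · intro hm
    obtain ⟨K, hK, hP⟩ := aux_shift T hT
    refine ⟨K / lam, lam • (1 : Matrix ι ι ℂ) + (lam / K) • T, lam • (1 : Matrix ι ι ℂ),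
      ⟨?_, ?_⟩, ⟨?_, ?_⟩, ?_⟩
    · have h := hP.smul (div_pos hlam hK).le
      rwa [smul_add, smul_smul, div_mul_cancel₀ _ hK.ne'] at h
    · rw [add_sub_cancel_left]
      exact Δ.smul_mem _ hm
    · exact PosSemidef.one.smul hlam.le
    · rw [sub_self]
      exact Δ.zero_mem
    · rw [add_sub_cancel_left, smul_smul]
      have : K / lam * (lam / K) = 1 := by field_simp
      rw [this, one_smul]
  · rintro ⟨c, X₁, X₂, h1, h2, rfl⟩
    have h := Δ.sub_mem h1.2 h2.2
    rw [sub_sub_sub_cancel_right] at h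
    exact Δ.smul_mem _ h

end
end

section
/- Let (λ_x, Δ_x) be a type datum on H_x and (λ_y, Δ_y) a type datum on H_y, with deterministic sets D_x and D_y. Define M := { F : F PSD on H_x⊗H_y and Tr[F·(X⊗Y)] = 1 for every X ∈ D_x and Y ∈ D_y }. Then { G : G PSD on H_x⊗H_y and Tr[G·F] = 1 for every F ∈ M } equals the set of PSD operators on H_x⊗H_y lying in the affine span (over ℝ, inside the Hermitian operators on H_x⊗H_y) of { X⊗Y : X ∈ D_x, Y ∈ D_y }. -/
open Matrix Kronecker ComplexOrder

noncomputable section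

theorem aux_repr {n : Type} [Fintype n] [DecidableEq n] (f : Matrix n n ℂ →ₗ[ℝ] ℝ) :
    ∃ H : Matrix n n ℂ, H.IsHermitian ∧ ∀ Z : Matrix n n ℂ, Z.IsHermitian →
      (H * Z).trace = (f Z : ℂ) := by
  let K : Matrix n n ℂ := fun j i =>
    (f (Matrix.single i j 1) : ℂ) - Complex.I * (f (Matrix.single i j Complex.I) : ℂ)
  have hK : ∀ Z : Matrix n n ℂ, (K * Z).trace.re = f Z := by
    intro Z
    conv_rhs => rw [Matrix.matrix_eq_sum_single Z]
    rw [map_sum]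
    simp only [map_sum]
    simp only [Matrix.trace, Matrix.diag, Matrix.mul_apply, Complex.re_sum]
    rw [Finset.sum_comm]
    refine Finset.sum_congr rfl fun i _ => Finset.sum_congr rfl fun j _ => ?_
    have : Matrix.single i j (Z i j) = (Z i j).re • Matrix.single i j (1:ℂ)
        + (Z i j).im • Matrix.single i j Complex.I := by
      rw [Matrix.smul_single, Matrix.smul_single, ← Matrix.single_add]
      congr 1
      apply Complex.ext <;> simp
    rw [this, map_add, map_smul, map_smul]
    simp [K]
    ring
  refine ⟨(1/2 : ℂ) • (K + Kᴴ), ?_, fun Z hZ => ?_⟩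
  · unfold Matrix.IsHermitian
    rw [Matrix.conjTranspose_smul, Matrix.conjTranspose_add, Matrix.conjTranspose_conjTranspose,
      add_comm Kᴴ]
    congr 1
    simp
  · have h1 : (Kᴴ * Z).trace = star (K * Z).trace := by
      rw [← Matrix.trace_conjTranspose, Matrix.conjTranspose_mul, hZ.eq, Matrix.trace_mul_comm]
    rw [Matrix.smul_mul, Matrix.add_mul, Matrix.trace_smul, Matrix.trace_add, h1, ← hK Z]
    apply Complex.ext <;> simp
    ring

section
open scoped Matrix.Norms.L2Operator MatrixOrder
theorem aux_psd {n : Type} [Fintype n] [DecidableEq n] (H : Matrix n n ℂ) (hH : H.IsHermitian) :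
    ∃ k0 : ℝ, ∀ k : ℝ, k0 ≤ k → (H + k • (1 : Matrix n n ℂ)).PosSemidef := by
  refine ⟨‖H‖, fun k hk => ?_⟩
  have h1 := IsSelfAdjoint.neg_algebraMap_norm_le_self (a := H) hH
  rw [Matrix.le_iff, sub_neg_eq_add, Algebra.algebraMap_eq_smul_one] at h1
  have h2 : ((k - ‖H‖) • (1 : Matrix n n ℂ)).PosSemidef :=
    Matrix.PosSemidef.one.smul (sub_nonneg.2 hk)
  have := h1.add h2
  have e : H + k • (1 : Matrix n n ℂ) = H + ‖H‖ • (1 : Matrix n n ℂ)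
      + (k - ‖H‖) • (1 : Matrix n n ℂ) := by
    rw [sub_smul]; abel
  rw [e]
  exact this
end

theorem aux_det_herm {n : Type} [Fintype n] [DecidableEq n] {l : ℝ} {Δ : Submodule ℝ (Matrix n n ℂ)}
    (hΔ : ∀ T ∈ Δ, T.IsHermitian ∧ T.trace = 0) {X : Matrix n n ℂ}
    (hX : X ∈ detSet l (Δ : Set (Matrix n n ℂ))) :
    X.trace = ((l * Fintype.card n : ℝ) : ℂ) := by
  have := (hΔ _ hX.2).2
  rw [Matrix.trace_sub, sub_eq_zero, Matrix.trace_smul, Matrix.trace_one] at this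
  rw [this]; simp

theorem aux_det_mem {n : Type} [Fintype n] [DecidableEq n] {l : ℝ} (hl : 0 < l)
    (Δ : Submodule ℝ (Matrix n n ℂ)) :
    l • (1 : Matrix n n ℂ) ∈ detSet l (Δ : Set (Matrix n n ℂ)) :=
  ⟨Matrix.PosSemidef.one.smul hl.le, by simp⟩

/-- with `M := {F PSD | Tr[F·(X⊗Y)] = 1 ∀ X ∈ D_x, Y ∈ D_y}`, the set
`{G PSD | Tr[G·F] = 1 ∀ F ∈ M}` equals the set of PSD operators in the affine span of
`{X⊗Y : X ∈ D_x, Y ∈ D_y}`. -/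
theorem stmt_10 {ιx ιy : Type} [Fintype ιx] [DecidableEq ιx] [Nonempty ιx]
    [Fintype ιy] [DecidableEq ιy] [Nonempty ιy]
    (lamx lamy : ℝ) (hlamx : 0 < lamx) (hlamy : 0 < lamy)
    (Δx : Submodule ℝ (Matrix ιx ιx ℂ)) (Δy : Submodule ℝ (Matrix ιy ιy ℂ))
    (hΔx : ∀ T ∈ Δx, T.IsHermitian ∧ T.trace = 0)
    (hΔy : ∀ T ∈ Δy, T.IsHermitian ∧ T.trace = 0) :
    {G : Matrix (ιx × ιy) (ιx × ιy) ℂ | G.PosSemidef ∧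
        ∀ F ∈ {F : Matrix (ιx × ιy) (ιx × ιy) ℂ | F.PosSemidef ∧
                ∀ X ∈ detSet lamx (Δx : Set (Matrix ιx ιx ℂ)),
                  ∀ Y ∈ detSet lamy (Δy : Set (Matrix ιy ιy ℂ)),
                    (F * (X ⊗ₖ Y)).trace = 1},
          (G * F).trace = 1} =
      {G : Matrix (ιx × ιy) (ιx × ιy) ℂ | G.PosSemidef ∧
        G ∈ affineSpan ℝ (Set.image2 (· ⊗ₖ ·)
              (detSet lamx (Δx : Set (Matrix ιx ιx ℂ)))
              (detSet lamy (Δy : Set (Matrix ιy ιy ℂ))))} := by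
  ext G
  simp only [Set.mem_ofPred_eq]
  refine and_congr_right fun hG => ⟨fun h => ?_, fun h F hF => ?_⟩
  swap
  · refine affineSpan_induction (p := fun G => (G * F).trace = 1) h ?_ ?_
    · rintro _ ⟨X, hX, Y, hY, rfl⟩
      rw [Matrix.trace_mul_comm]
      exact hF.2 X hX Y hY
    · intro c u v w hu hv hw
      simp only [vsub_eq_sub, vadd_eq_add, Matrix.add_mul, Matrix.smul_mul, Matrix.sub_mul,
        Matrix.trace_add, Matrix.trace_smul, Matrix.trace_sub, hu, hv, hw]
      simp
  · set S := Set.image2 (· ⊗ₖ ·) (detSet lamx (Δx : Set (Matrix ιx ιx ℂ)))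
              (detSet lamy (Δy : Set (Matrix ιy ιy ℂ))) with hS
    set c : Matrix (ιx × ιy) (ιx × ιy) ℂ := (lamx • (1 : Matrix ιx ιx ℂ)) ⊗ₖ (lamy • (1 : Matrix ιy ιy ℂ)) with hc
    have hcS : c ∈ S := ⟨_, aux_det_mem hlamx Δx, _, aux_det_mem hlamy Δy, rfl⟩
    set N : ℝ := (lamx * Fintype.card ιx) * (lamy * Fintype.card ιy) with hN
    have hNpos : 0 < N := by
      have : 0 < Fintype.card ιx := Fintype.card_pos
      have : 0 < Fintype.card ιy := Fintype.card_pos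
      positivity
    have htr : ∀ X ∈ detSet lamx (Δx : Set (Matrix ιx ιx ℂ)),
        ∀ Y ∈ detSet lamy (Δy : Set (Matrix ιy ιy ℂ)), (X ⊗ₖ Y).trace = (N : ℂ) := by
      intro X hX Y hY
      rw [Matrix.trace_kronecker, aux_det_herm hΔx hX, aux_det_herm hΔy hY, hN]
      push_cast; ring
    by_contra hGn
    have hGn' : G - c ∉ (affineSpan ℝ S).direction := fun hh =>
      hGn ((AffineSubspace.vsub_right_mem_direction_iff_mem (mem_affineSpan ℝ hcS) G).1 hh)
    obtain ⟨f, hf, hfV⟩ := Submodule.exists_le_ker_of_notMem hGn'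
    have hfS : ∀ Z ∈ S, f Z = f c := by
      intro Z hZ
      have : Z - c ∈ (affineSpan ℝ S).direction :=
        AffineSubspace.vsub_mem_direction (mem_affineSpan ℝ hZ) (mem_affineSpan ℝ hcS)
      have := hfV this
      rwa [LinearMap.mem_ker, map_sub, sub_eq_zero] at this
    obtain ⟨H, hH, hHf⟩ := aux_repr f
    obtain ⟨k0, hk0⟩ := aux_psd H hH
    -- general family
    have key : ∀ k : ℝ, k0 ≤ k → 0 < f c + k * N → f G + k * G.trace = f c + k * N := by
      intro k hk hpos
      have hne : ((f c + k * N : ℝ) : ℂ) ≠ 0 := by exact_mod_cast hpos.ne'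
      have := h ((f c + k * N)⁻¹ • (H + k • (1 : Matrix (ιx × ιy) (ιx × ιy) ℂ)))
        ⟨(hk0 k hk).smul (inv_nonneg.2 hpos.le), ?_⟩
      · rw [Matrix.trace_mul_comm, Matrix.smul_mul, Matrix.add_mul, Matrix.trace_smul,
          Matrix.trace_add, hHf G hG.1, Matrix.smul_mul, Matrix.one_mul, Matrix.trace_smul,
          Complex.real_smul, Complex.real_smul, Complex.ofReal_inv, inv_mul_eq_one₀ hne] at this
        rw [← this]; push_cast; ring
      · intro X hX Y hY
        have hXY : (X ⊗ₖ Y).IsHermitian := (hX.1.kronecker hY.1).1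
        rw [Matrix.smul_mul, Matrix.add_mul, Matrix.trace_smul,
          Matrix.trace_add, hHf _ hXY, Matrix.smul_mul, Matrix.one_mul, Matrix.trace_smul,
          htr X hX Y hY, hfS _ ⟨X, hX, Y, hY, rfl⟩,
          Complex.real_smul, Complex.real_smul, Complex.ofReal_inv, inv_mul_eq_one₀ hne]
        push_cast; ring
    have hG1 : G.trace = N := by
      have hne : (N : ℂ) ≠ 0 := by exact_mod_cast hNpos.ne'
      have := h (N⁻¹ • (1 : Matrix (ιx × ιy) (ιx × ιy) ℂ))
        ⟨Matrix.PosSemidef.one.smul (inv_nonneg.2 hNpos.le), ?_⟩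
      · rw [Matrix.mul_smul, Matrix.mul_one, Matrix.trace_smul, Complex.real_smul,
          Complex.ofReal_inv, inv_mul_eq_one₀ hne] at this
        exact this.symm
      · intro X hX Y hY
        rw [Matrix.smul_mul, Matrix.one_mul, Matrix.trace_smul, htr X hX Y hY, Complex.real_smul,
          Complex.ofReal_inv, inv_mul_cancel₀ hne]
    have hk := key (max k0 ((1 - f c) / N)) (le_max_left _ _) (by
      have := le_max_right k0 ((1 - f c) / N)
      rw [div_le_iff₀ hNpos] at this
      linarith)
    rw [hG1] at hk
    apply hf
    have : (f G : ℂ) = f c := by simpa using hk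
    rw [map_sub, sub_eq_zero]
    exact_mod_cast this

end
end

section
/- Let (λ_x,Δ_x), (λ_y,Δ_y), (λ_z,Δ_z) be type data on the same finite-dimensional Hilbert space H, with deterministic sets D_x, D_y, D_z. Then D_z = D_x ∩ D_y if and only if λ_z = λ_x = λ_y and Δ_z = Δ_x ∩ Δ_y. -/
open Matrix Kronecker ComplexOrder

noncomputable section

open scoped MatrixOrder Matrix.Norms.L2Operator in
theorem exists_eps_psd {ι : Type} [Fintype ι] [DecidableEq ι] (lam : ℝ) (hlam : 0 < lam)
    (T : Matrix ι ι ℂ) (hT : T.IsHermitian) :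
    ∃ ε : ℝ, 0 < ε ∧ (lam • (1 : Matrix ι ι ℂ) + ε • T).PosSemidef := by
  have h := IsSelfAdjoint.neg_algebraMap_norm_le_self (a := T) hT
  have hp : (T + ‖T‖ • (1 : Matrix ι ι ℂ)).PosSemidef := by
    have h2 := Matrix.le_iff.mp h
    rwa [sub_neg_eq_add, Algebra.algebraMap_eq_smul_one] at h2
  have hn : 0 < ‖T‖ + 1 := by positivity
  refine ⟨lam / (‖T‖ + 1), by positivity, ?_⟩
  have h3 : (T + ‖T‖ • (1 : Matrix ι ι ℂ) + 1).PosSemidef := hp.add Matrix.PosSemidef.one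
  have h4 := h3.smul (show (0:ℝ) ≤ lam / (‖T‖ + 1) by positivity)
  convert h4 using 1
  have : lam = lam / (‖T‖ + 1) * ‖T‖ + lam / (‖T‖ + 1) := by field_simp
  generalize lam / (‖T‖ + 1) = c at this
  rw [this]
  module

theorem smul_one_traceless {ι : Type} [Fintype ι] [DecidableEq ι] [Nonempty ι] (a b : ℝ)
    (h : (a • (1 : Matrix ι ι ℂ) - b • (1 : Matrix ι ι ℂ)).trace = 0) : a = b := by
  rw [← sub_smul, Matrix.trace_smul, Matrix.trace_one] at h
  rcases smul_eq_zero.mp h with h | h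
  · linarith
  · simp at h

/-- for type data `(λ_x,Δ_x)`, `(λ_y,Δ_y)`, `(λ_z,Δ_z)` on the same space
with deterministic sets `D_x, D_y, D_z`, one has `D_z = D_x ∩ D_y` iff
`λ_z = λ_x = λ_y` and `Δ_z = Δ_x ∩ Δ_y`. -/
theorem stmt_13 {ι : Type} [Fintype ι] [DecidableEq ι] [Nonempty ι]
    (lamx lamy lamz : ℝ) (hlamx : 0 < lamx) (hlamy : 0 < lamy) (hlamz : 0 < lamz)
    (Δx Δy Δz : Submodule ℝ (Matrix ι ι ℂ))
    (hΔx : ∀ T ∈ Δx, T.IsHermitian ∧ T.trace = 0)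
    (hΔy : ∀ T ∈ Δy, T.IsHermitian ∧ T.trace = 0)
    (hΔz : ∀ T ∈ Δz, T.IsHermitian ∧ T.trace = 0) :
    detSet lamz (Δz : Set (Matrix ι ι ℂ)) =
        detSet lamx (Δx : Set (Matrix ι ι ℂ)) ∩ detSet lamy (Δy : Set (Matrix ι ι ℂ)) ↔
      lamz = lamx ∧ lamz = lamy ∧ Δz = Δx ⊓ Δy := by
  constructor
  · intro h
    have h1 : lamz • (1 : Matrix ι ι ℂ) ∈ detSet lamz (Δz : Set (Matrix ι ι ℂ)) :=
      ⟨Matrix.PosSemidef.one.smul hlamz.le, by simp⟩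
    rw [h] at h1
    obtain ⟨⟨_, hx⟩, ⟨_, hy⟩⟩ := h1
    have ex := smul_one_traceless _ _ (hΔx _ hx).2
    have ey := smul_one_traceless _ _ (hΔy _ hy).2
    subst ex
    subst ey
    refine ⟨rfl, rfl, ?_⟩
    have key : ∀ T : Matrix ι ι ℂ, T.IsHermitian → (T ∈ Δz ↔ T ∈ Δx ∧ T ∈ Δy) := by
      intro T hT
      obtain ⟨ε, hε, hp⟩ := exists_eps_psd lamz hlamz T hT
      have hm : ∀ Δ : Submodule ℝ (Matrix ι ι ℂ),
          (lamz • (1 : Matrix ι ι ℂ) + ε • T ∈ detSet lamz (Δ : Set (Matrix ι ι ℂ)) ↔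
            T ∈ Δ) := by
        intro Δ
        simp only [detSet, Set.mem_ofPred_eq, add_sub_cancel_left, SetLike.mem_coe]
        rw [Δ.smul_mem_iff hε.ne']
        exact and_iff_right hp
      rw [← hm Δz, ← hm Δx, ← hm Δy, h]
      rfl
    ext T
    rw [Submodule.mem_inf]
    exact ⟨fun hT => (key T (hΔz T hT).1).1 hT, fun hT => (key T (hΔx T hT.1).1).2 hT⟩
  · rintro ⟨rfl, rfl, rfl⟩
    ext X
    simp only [detSet, Set.mem_ofPred_eq, Set.mem_inter_iff, SetLike.mem_coe, Submodule.mem_inf]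
    tauto

end
end

section
/- Let (λ,Δ_x) and (λ,Δ_y) be type data on the same finite-dimensional Hilbert space H with a common λ > 0 and deterministic sets D_x, D_y, and let (λ_z,Δ_z) be a type datum on H_z with deterministic set D_z. For deterministic-type sets D on K and D' on K', write D⊠D' := the set of PSD operators on K⊗K' lying in the affine span (over ℝ, inside the Hermitian operators on K⊗K') of { U⊗V : U ∈ D, V ∈ D' }. Then (D_x ∩ D_y)⊠D_z = (D_x⊠D_z) ∩ (D_y⊠D_z). -/
open Matrix Kronecker ComplexOrder

noncomputable section

/-- `D ⊠ D'`: the set of PSD operators on `K⊗K'` lying in the affine span (over ℝ) of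
`{U ⊗ V : U ∈ D, V ∈ D'}`. -/
def boxTimes {α β : Type*} [Fintype α] [DecidableEq α] [Fintype β] [DecidableEq β]
    (D : Set (Matrix α α ℂ)) (D' : Set (Matrix β β ℂ)) :
    Set (Matrix (α × β) (α × β) ℂ) :=
  {G | G.PosSemidef ∧ G ∈ affineSpan ℝ (Set.image2 (· ⊗ₖ ·) D D')}

theorem aux_aff {E : Type*} [AddCommGroup E] [Module ℝ E] (S : Set E) (f : E →ₗ[ℝ] ℝ) (c : ℝ)
    (hc : c ≠ 0) (hS : ∀ s ∈ S, f s = c) (hne : S.Nonempty) (p : E) :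
    p ∈ affineSpan ℝ S ↔ p ∈ Submodule.span ℝ S ∧ f p = c := by
  constructor
  · intro hp
    refine affineSpan_induction (p := fun p => p ∈ Submodule.span ℝ S ∧ f p = c) hp ?_ ?_
    · intro x hx
      exact ⟨Submodule.subset_span hx, hS x hx⟩
    · intro a u v w hu hv hw
      refine ⟨Submodule.add_mem _ (Submodule.smul_mem _ _ (Submodule.sub_mem _ hu.1 hv.1)) hw.1, ?_⟩
      simp [hu.2, hv.2, hw.2]
  · rintro ⟨hp, hf⟩
    obtain ⟨s0, hs0⟩ := hne
    have key : p - (f p / c) • s0 ∈ vectorSpan ℝ S := by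
      clear hf
      induction hp using Submodule.span_induction with
      | mem x hx =>
        rw [hS x hx, div_self hc, one_smul]
        exact vsub_mem_vectorSpan ℝ hx hs0
      | zero => simp
      | add x y _ _ hx hy =>
        have := Submodule.add_mem _ hx hy
        convert this using 1
        rw [map_add, add_div, add_smul]; abel
      | smul a x _ hx =>
        have := Submodule.smul_mem _ a hx
        convert this using 1
        rw [map_smul, smul_eq_mul, mul_div_assoc, mul_smul, smul_sub]
    rw [hf, div_self hc, one_smul, ← direction_affineSpan] at key
    have := AffineSubspace.vadd_mem_of_mem_direction key (mem_affineSpan ℝ hs0)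
    simpa using this

open scoped MatrixOrder Matrix.Norms.L2Operator in
theorem aux_psd_s16 {ι : Type*} [Fintype ι] [DecidableEq ι] (T : Matrix ι ι ℂ) (hT : T.IsHermitian) :
    ∃ t : ℝ, 0 < t ∧ (T + t • (1 : Matrix ι ι ℂ)).PosSemidef := by
  refine ⟨‖T‖ + 1, by positivity, ?_⟩
  have h : IsSelfAdjoint T := hT
  have h1 := h.neg_algebraMap_norm_le_self
  rw [Matrix.le_iff, Algebra.algebraMap_eq_smul_one] at h1
  have h2 : ((1:ℝ) • (1 : Matrix ι ι ℂ)).PosSemidef := by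
    rw [one_smul]; exact Matrix.PosSemidef.one
  have h3 : T + (‖T‖ + 1) • (1 : Matrix ι ι ℂ) = (T - -(‖T‖ • 1)) + (1:ℝ) • 1 := by
    rw [add_smul]; abel
  rw [h3]
  exact h1.add h2

/-- The Kronecker product as a real bilinear map. -/
def kronR (ι κ : Type*) : Matrix ι ι ℂ →ₗ[ℝ] Matrix κ κ ℂ →ₗ[ℝ] Matrix (ι × κ) (ι × κ) ℂ :=
  Matrix.kroneckerMapBilinear (LinearMap.mul ℝ ℂ)

theorem kronR_apply {ι κ : Type*} (A : Matrix ι ι ℂ) (B : Matrix κ κ ℂ) :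
    kronR ι κ A B = A ⊗ₖ B := rfl

theorem aux_one_mem {ι : Type*} [Fintype ι] [DecidableEq ι] (lam : ℝ) (hlam : 0 < lam)
    (Δ : Submodule ℝ (Matrix ι ι ℂ)) :
    lam • (1 : Matrix ι ι ℂ) ∈ detSet lam (Δ : Set (Matrix ι ι ℂ)) := by
  refine ⟨Matrix.PosSemidef.one.smul hlam.le, ?_⟩
  simp

theorem aux_span {ι : Type*} [Fintype ι] [DecidableEq ι] (lam : ℝ) (hlam : 0 < lam)
    (Δ : Submodule ℝ (Matrix ι ι ℂ)) (hΔ : ∀ T ∈ Δ, T.IsHermitian ∧ T.trace = 0) :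
    Submodule.span ℝ (detSet lam (Δ : Set (Matrix ι ι ℂ))) = Submodule.span ℝ {1} ⊔ Δ := by
  apply le_antisymm
  · rw [Submodule.span_le]
    rintro X ⟨_, hX⟩
    rw [SetLike.mem_coe, Submodule.mem_sup]
    exact ⟨lam • 1, Submodule.smul_mem _ _ (Submodule.mem_span_singleton_self _), _, hX, by abel⟩
  · have h1 := Submodule.subset_span (R := ℝ) (aux_one_mem lam hlam Δ)
    refine sup_le ?_ ?_
    · rw [Submodule.span_singleton_le_iff_mem]
      have := Submodule.smul_mem _ lam⁻¹ h1
      rwa [smul_smul, inv_mul_cancel₀ hlam.ne', one_smul] at this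
    · intro T hT
      obtain ⟨t, ht, hp⟩ := aux_psd_s16 T (hΔ T hT).1
      have hX : (lam / t) • (T + t • (1 : Matrix ι ι ℂ)) ∈ detSet lam (Δ : Set (Matrix ι ι ℂ)) := by
        refine ⟨hp.smul (by positivity), ?_⟩
        rw [smul_add, smul_smul, div_mul_cancel₀ _ ht.ne', add_sub_cancel_right]
        exact Submodule.smul_mem _ _ hT
      have := Submodule.smul_mem _ (t / lam)
        (Submodule.sub_mem _ (Submodule.subset_span (R := ℝ) hX) h1)
      rw [smul_add, smul_smul, div_mul_cancel₀ _ ht.ne', add_sub_cancel_right, smul_smul,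
        div_mul_div_comm, mul_comm t lam, div_self (by positivity), one_smul] at this
      exact this

theorem aux_inf {ι : Type*} [Fintype ι] [DecidableEq ι] [Nonempty ι]
    (Δx Δy : Submodule ℝ (Matrix ι ι ℂ))
    (hΔx : ∀ T ∈ Δx, T.IsHermitian ∧ T.trace = 0)
    (hΔy : ∀ T ∈ Δy, T.IsHermitian ∧ T.trace = 0) :
    Submodule.span ℝ {(1 : Matrix ι ι ℂ)} ⊔ (Δx ⊓ Δy) =
      (Submodule.span ℝ {1} ⊔ Δx) ⊓ (Submodule.span ℝ {1} ⊔ Δy) := by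
  apply le_antisymm
  · exact le_inf (sup_le_sup_left inf_le_left _) (sup_le_sup_left inf_le_right _)
  · rintro X ⟨h1, h2⟩
    simp only [SetLike.mem_coe, Submodule.mem_sup, Submodule.mem_span_singleton] at h1 h2 ⊢
    obtain ⟨_, ⟨a, rfl⟩, S, hS, rfl⟩ := h1
    obtain ⟨_, ⟨b, rfl⟩, T, hT, h⟩ := h2
    have htr := congrArg Matrix.trace h
    simp only [Matrix.trace_add, Matrix.trace_smul, (hΔx S hS).2, (hΔy T hT).2, add_zero,
      Matrix.trace_one] at htr
    have hab : b = a := by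
      have hn : ((Fintype.card ι : ℕ) : ℂ) ≠ 0 := by exact_mod_cast Fintype.card_ne_zero
      exact smul_left_injective ℝ hn htr
    subst hab
    have : T = S := by simpa using h
    subst this
    exact ⟨_, ⟨b, rfl⟩, T, ⟨hS, hT⟩, rfl⟩

theorem aux_indep {κ n : Type*} [Fintype n] (z : n → Matrix κ κ ℂ)
    (hz : ∀ j, (z j).IsHermitian) (hli : LinearIndependent ℝ z) (c : n → ℂ)
    (h : ∑ j, c j • z j = 0) : c = 0 := by
  have h' : ∑ j, star (c j) • z j = 0 := by
    have := congrArg Matrix.conjTranspose h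
    simpa [Matrix.conjTranspose_sum, Matrix.conjTranspose_smul, fun j => (hz j).eq] using this
  rw [Fintype.linearIndependent_iff] at hli
  have hre := hli (fun j => (c j).re) (by
    have : ∑ j, ((2 : ℂ)⁻¹ * (c j + star (c j))) • z j = 0 := by
      simp only [mul_smul, add_smul, ← Finset.smul_sum, Finset.sum_add_distrib, h, h']
      simp
    rw [← this]
    refine Finset.sum_congr rfl fun j _ => ?_
    rw [← Complex.coe_smul]
    congr 1
    apply Complex.ext <;> simp
    ring)
  have him := hli (fun j => (c j).im) (by
    have : ∑ j, ((2 : ℂ)⁻¹ * -Complex.I * (c j - star (c j))) • z j = 0 := by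
      simp only [mul_smul, sub_smul, ← Finset.smul_sum, Finset.sum_sub_distrib, h, h']
      simp
    rw [← this]
    refine Finset.sum_congr rfl fun j _ => ?_
    rw [← Complex.coe_smul]
    congr 1
    apply Complex.ext <;> simp
    ring)
  funext j
  exact Complex.ext (hre j) (him j)

theorem aux_rep {ι κ n : Type*} [Fintype n] (A : Submodule ℝ (Matrix ι ι ℂ))
    (B : Submodule ℝ (Matrix κ κ ℂ)) (b : Module.Basis n ℝ B) (G : Matrix (ι × κ) (ι × κ) ℂ)
    (hG : G ∈ Submodule.map₂ (kronR ι κ) A B) :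
    ∃ a : n → Matrix ι ι ℂ, (∀ j, a j ∈ A) ∧ G = ∑ j, kronR ι κ (a j) (b j : Matrix κ κ ℂ) := by
  rw [Submodule.map₂_eq_span_image2] at hG
  induction hG using Submodule.span_induction with
  | mem g hg =>
    obtain ⟨x, hx, y, hy, rfl⟩ := hg
    refine ⟨fun j => b.repr ⟨y, hy⟩ j • x, fun j => A.smul_mem _ hx, ?_⟩
    have h := congrArg Subtype.val (b.sum_repr ⟨y, hy⟩)
    simp only [Submodule.coe_sum, Submodule.coe_smul] at h
    conv_lhs => rw [← h]
    simp
  | zero => exact ⟨0, fun j => A.zero_mem, by simp⟩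
  | smul t u hu iu =>
    obtain ⟨p, hp, rfl⟩ := iu
    exact ⟨t • p, fun j => A.smul_mem _ (hp j), by simp [Finset.smul_sum]⟩
  | add u v hu hv iu iv =>
    obtain ⟨p, hp, rfl⟩ := iu
    obtain ⟨q, hq, rfl⟩ := iv
    exact ⟨p + q, fun j => A.add_mem (hp j) (hq j), by simp [Finset.sum_add_distrib]⟩

theorem aux_map₂ {ι κ : Type*} [Fintype κ] (A A' : Submodule ℝ (Matrix ι ι ℂ))
    (B : Submodule ℝ (Matrix κ κ ℂ)) (hB : ∀ T ∈ B, T.IsHermitian) :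
    Submodule.map₂ (kronR ι κ) (A ⊓ A') B =
      Submodule.map₂ (kronR ι κ) A B ⊓ Submodule.map₂ (kronR ι κ) A' B := by
  apply le_antisymm
  · exact le_inf (Submodule.map₂_le_map₂_left inf_le_left)
      (Submodule.map₂_le_map₂_left inf_le_right)
  · rintro G ⟨h1, h2⟩
    have b := Module.finBasis ℝ B
    obtain ⟨p, hp, rfl⟩ := aux_rep A B b G h1
    obtain ⟨q, hq, h⟩ := aux_rep A' B b _ h2
    have hli : LinearIndependent ℝ (fun j => (b j : Matrix κ κ ℂ)) :=
      b.linearIndependent.map' B.subtype (Submodule.ker_subtype B)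
    have hpq : p = q := by
      funext j
      ext r s
      have := aux_indep (fun j => (b j : Matrix κ κ ℂ)) (fun j => hB _ (b j).2) hli
        (fun j => p j r s - q j r s) (by
          ext u v
          have := congrFun (congrFun h (r, u)) (s, v)
          simp only [Matrix.sum_apply, kronR_apply, Matrix.kroneckerMap_apply] at this
          simp [Matrix.sum_apply, sub_mul, this])
      exact sub_eq_zero.mp (congrFun this j)
    subst hpq
    exact Submodule.sum_mem _ fun j _ =>
      Submodule.apply_mem_map₂ _ ⟨hp j, hq j⟩ (b j).2

theorem aux_tr {μ : Type*} [Fintype μ] [DecidableEq μ] (l : ℝ) (D : Submodule ℝ (Matrix μ μ ℂ))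
    (hD : ∀ T ∈ D, T.IsHermitian ∧ T.trace = 0) (X : Matrix μ μ ℂ)
    (hX : X ∈ detSet l (D : Set (Matrix μ μ ℂ))) :
    X.trace = ((l * Fintype.card μ : ℝ) : ℂ) := by
  have := (hD _ hX.2).2
  rw [Matrix.trace_sub, Matrix.trace_smul, Matrix.trace_one, sub_eq_zero] at this
  rw [this]; simp

theorem aux_box {ι κ : Type*} [Fintype ι] [DecidableEq ι] [Nonempty ι]
    [Fintype κ] [DecidableEq κ] [Nonempty κ]
    (lam lamz : ℝ) (hlam : 0 < lam) (hlamz : 0 < lamz)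
    (Δ : Submodule ℝ (Matrix ι ι ℂ)) (Δz : Submodule ℝ (Matrix κ κ ℂ))
    (hΔ : ∀ T ∈ Δ, T.IsHermitian ∧ T.trace = 0)
    (hΔz : ∀ T ∈ Δz, T.IsHermitian ∧ T.trace = 0) (G : Matrix (ι × κ) (ι × κ) ℂ) :
    G ∈ boxTimes (detSet lam (Δ : Set (Matrix ι ι ℂ))) (detSet lamz (Δz : Set (Matrix κ κ ℂ))) ↔
      G.PosSemidef ∧ G ∈ Submodule.map₂ (kronR ι κ) (Submodule.span ℝ {1} ⊔ Δ)
        (Submodule.span ℝ {1} ⊔ Δz) ∧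
        (Matrix.trace G).re = lam * Fintype.card ι * (lamz * Fintype.card κ) := by
  have hc : lam * Fintype.card ι * (lamz * Fintype.card κ) ≠ 0 := by
    have := Fintype.card_pos (α := ι)
    have := Fintype.card_pos (α := κ)
    positivity
  rw [← aux_span lam hlam Δ hΔ, ← aux_span lamz hlamz Δz hΔz, Submodule.map₂_span_span]
  refine and_congr Iff.rfl ?_
  refine aux_aff _ (Complex.reLm ∘ₗ Matrix.traceLinearMap (ι × κ) ℝ ℂ) _ hc ?_ ?_ G
  · rintro _ ⟨U, hU, V, hV, rfl⟩
    simp only [LinearMap.comp_apply, Matrix.traceLinearMap_apply, Matrix.trace_kronecker,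
      aux_tr lam Δ hΔ U hU, aux_tr lamz Δz hΔz V hV, ← Complex.ofReal_mul]
    exact Complex.ofReal_re _
  · exact ⟨_, _, aux_one_mem lam hlam Δ, _, aux_one_mem lamz hlamz Δz, rfl⟩

/-- for type data `(λ,Δ_x)`, `(λ,Δ_y)` on the same space with a common `λ`,
and a type datum `(λ_z,Δ_z)`, one has `(D_x ∩ D_y) ⊠ D_z = (D_x ⊠ D_z) ∩ (D_y ⊠ D_z)`. -/
theorem stmt_16 {ι ιz : Type} [Fintype ι] [DecidableEq ι] [Nonempty ι]
    [Fintype ιz] [DecidableEq ιz] [Nonempty ιz]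
    (lam lamz : ℝ) (hlam : 0 < lam) (hlamz : 0 < lamz)
    (Δx Δy : Submodule ℝ (Matrix ι ι ℂ)) (Δz : Submodule ℝ (Matrix ιz ιz ℂ))
    (hΔx : ∀ T ∈ Δx, T.IsHermitian ∧ T.trace = 0)
    (hΔy : ∀ T ∈ Δy, T.IsHermitian ∧ T.trace = 0)
    (hΔz : ∀ T ∈ Δz, T.IsHermitian ∧ T.trace = 0) :
    boxTimes (detSet lam (Δx : Set (Matrix ι ι ℂ)) ∩ detSet lam (Δy : Set (Matrix ι ι ℂ)))
        (detSet lamz (Δz : Set (Matrix ιz ιz ℂ))) =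
      boxTimes (detSet lam (Δx : Set (Matrix ι ι ℂ))) (detSet lamz (Δz : Set (Matrix ιz ιz ℂ))) ∩
      boxTimes (detSet lam (Δy : Set (Matrix ι ι ℂ))) (detSet lamz (Δz : Set (Matrix ιz ιz ℂ))) := by
  have hxy : detSet lam (Δx : Set (Matrix ι ι ℂ)) ∩ detSet lam (Δy : Set (Matrix ι ι ℂ)) =
      detSet lam ((Δx ⊓ Δy : Submodule ℝ (Matrix ι ι ℂ)) : Set (Matrix ι ι ℂ)) := by
    ext X
    simp only [detSet, Set.mem_inter_iff, Set.mem_ofPred_eq, SetLike.mem_coe, Submodule.mem_inf]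
    tauto
  have hB : ∀ T ∈ Submodule.span ℝ {(1 : Matrix ιz ιz ℂ)} ⊔ Δz, T.IsHermitian := by
    intro T hT
    rw [Submodule.mem_sup] at hT
    obtain ⟨u, hu, v, hv, rfl⟩ := hT
    obtain ⟨a, rfl⟩ := Submodule.mem_span_singleton.mp hu
    refine Matrix.IsHermitian.add ?_ (hΔz v hv).1
    simp [Matrix.IsHermitian, Matrix.conjTranspose_smul]
  rw [hxy]
  ext G
  rw [Set.mem_inter_iff, aux_box lam lamz hlam hlamz (Δx ⊓ Δy) _ (fun T hT => hΔx T hT.1) hΔz,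
    aux_box lam lamz hlam hlamz _ _ hΔx hΔz, aux_box lam lamz hlam hlamz _ _ hΔy hΔz,
    aux_inf Δx Δy hΔx hΔy, aux_map₂ _ _ _ hB, Submodule.mem_inf]
  tauto

end
end

section
/- Let (λ,Δ_x) and (λ,Δ_y) be type data on the same finite-dimensional Hilbert space H_0 with a common λ > 0, and let (λ_z,Δ_z) be a type datum on H_z with deterministic set D_z. For a type datum a = (λ_a,Δ_a) on H_0 with deterministic set D_a, define D(a→z) := { R : R PSD on H_0⊗H_z and for every X ∈ D_a the partial trace Tr_{H_0}[(X⊗I_{H_z})·R] belongs to D_z }. Let x∩y denote the type datum (λ, Δ_x ∩ Δ_y) on H_0. Then D((x∩y)→z) equals the set of PSD operators on H_0⊗H_z lying in the affine span (over ℝ, inside the Hermitian operators on H_0⊗H_z) of D(x→z) ∪ D(y→z). -/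
open Matrix Kronecker ComplexOrder

noncomputable section

/-- `D(a→z)`: PSD operators `R` on `H_0⊗H_z` such that `Tr_{H_0}[(X⊗I)·R] ∈ D_z`
for every `X ∈ D_a`. -/
def detArrow {ι0 ιz : Type} [Fintype ι0] [DecidableEq ι0] [Fintype ιz] [DecidableEq ιz]
    (Da : Set (Matrix ι0 ι0 ℂ)) (Dz : Set (Matrix ιz ιz ℂ)) :
    Set (Matrix (ι0 × ιz) (ι0 × ιz) ℂ) :=
  {R | R.PosSemidef ∧ ∀ X ∈ Da, ptrLeft ((X ⊗ₖ (1 : Matrix ιz ιz ℂ)) * R) ∈ Dz}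

open scoped Matrix.Norms.L2Operator MatrixOrder in
lemma aux_norm {n : Type} [Fintype n] [DecidableEq n] (H : Matrix n n ℂ) (hH : H.IsHermitian) :
    ∃ c : ℝ, 0 ≤ c ∧ (H + c • (1 : Matrix n n ℂ)).PosSemidef := by
  have := IsSelfAdjoint.neg_algebraMap_norm_le_self (a := H) hH
  refine ⟨‖H‖, norm_nonneg _, ?_⟩
  rw [Matrix.le_iff] at this
  rw [Algebra.algebraMap_eq_smul_one, sub_neg_eq_add] at this
  exact this

lemma aux_psd_smul {n : Type} [Fintype n] [DecidableEq n] {A : Matrix n n ℂ} (hA : A.PosSemidef)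
    {c : ℝ} (hc : 0 ≤ c) : (c • A).PosSemidef := by
  have h := hA.smul (a := (c : ℂ)) (by exact_mod_cast hc)
  convert h using 1
  ext i j
  simp [Matrix.smul_apply]

lemma aux_pert {n : Type} [Fintype n] [DecidableEq n] (H : Matrix n n ℂ) (hH : H.IsHermitian)
    (c : ℝ) (hc : 0 < c) : ∃ e : ℝ, 0 < e ∧ (c • (1 : Matrix n n ℂ) + e • H).PosSemidef := by
  obtain ⟨d, hd, h⟩ := aux_norm H hH
  refine ⟨c / (d + 1), by positivity, ?_⟩
  have h1 := aux_psd_smul h (c := c / (d + 1)) (by positivity)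
  have h2 := aux_psd_smul (Matrix.PosSemidef.one (n := n) (R := ℂ)) (c := c / (d + 1)) (by positivity)
  have h3 := h1.add h2
  convert h3 using 1
  have : c = c / (d+1) * d + c / (d+1) := by field_simp
  rw [smul_add, smul_smul]
  nth_rewrite 1 [this]
  rw [add_smul]
  abel

lemma aux_proj {K V : Type*} [Field K] [AddCommGroup V] [Module K V] (W1 W2 : Submodule K V) :
    ∃ P : V →ₗ[K] V, (∀ x, P x ∈ W1) ∧ (∀ x ∈ W1, P x = x) ∧ ∀ x ∈ W2, P x ∈ W1 ⊓ W2 := by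
  obtain ⟨U, hU, hU2⟩ := IsModularLattice.exists_disjoint_and_sup_eq
    (inf_le_right : W1 ⊓ W2 ≤ W2)
  have hUW : U ≤ W2 := hU2 ▸ le_sup_right
  have hd : Disjoint W1 U := by
    rw [disjoint_iff_inf_le]
    refine le_trans ?_ (disjoint_iff_inf_le.1 hU)
    exact le_inf (le_inf inf_le_left (inf_le_right.trans hUW)) inf_le_right
  obtain ⟨C, hC, hUC⟩ : ∃ C, U ≤ C ∧ IsCompl W1 C := by
    obtain ⟨C, h⟩ := hd.symm.exists_isCompl
    exact ⟨C, h.1, h.2.symm⟩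
  refine ⟨W1.projection C hUC, Submodule.projection_apply_mem hUC,
    fun x hx => Submodule.projection_apply_of_mem_left hUC hx, fun x hx => ?_⟩
  rw [← hU2] at hx
  obtain ⟨u, hu, v, hv, rfl⟩ := Submodule.mem_sup.1 hx
  rw [map_add, Submodule.projection_apply_of_mem_left hUC hu.1,
    (Submodule.projection_apply_eq_zero_iff hUC).2 (hC hv), add_zero]
  exact hu

section
variable {ι0 ιz : Type} [Fintype ι0] [DecidableEq ι0] [Fintype ιz] [DecidableEq ιz]

lemma aux_entry (X : Matrix ι0 ι0 ℂ) (R : Matrix (ι0 × ιz) (ι0 × ιz) ℂ) (b b' : ιz) :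
    ptrLeft ((X ⊗ₖ (1 : Matrix ιz ιz ℂ)) * R) b b' = ∑ a, ∑ c, X a c * R (c, b) (a, b') := by
  simp [ptrLeft, Matrix.mul_apply, Fintype.sum_prod_type, Matrix.one_apply]

def auxL : Matrix (ι0 × ιz) (ι0 × ιz) ℂ →ₗ[ℝ] Matrix ι0 ι0 ℂ →ₗ[ℝ] Matrix ιz ιz ℂ :=
  LinearMap.mk₂ ℝ (fun R X => ptrLeft ((X ⊗ₖ (1 : Matrix ιz ιz ℂ)) * R))
    (by intros; ext b b'; rw [Matrix.add_apply]; simp only [aux_entry]; simp only [Matrix.add_apply, mul_add, Finset.sum_add_distrib])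
    (by intros; ext b b'; rw [Matrix.smul_apply]; simp only [aux_entry]; simp only [Matrix.smul_apply, mul_smul_comm, Finset.smul_sum])
    (by intros; ext b b'; simp only [aux_entry, Matrix.add_apply, add_mul, Finset.sum_add_distrib])
    (by intros; ext b b'; simp only [aux_entry, Matrix.smul_apply, smul_mul_assoc, Finset.smul_sum])

lemma auxL_apply (X : Matrix ι0 ι0 ℂ) (R : Matrix (ι0 × ιz) (ι0 × ιz) ℂ) :
    auxL R X = ptrLeft ((X ⊗ₖ (1 : Matrix ιz ιz ℂ)) * R) := rfl

lemma auxL_entry (X : Matrix ι0 ι0 ℂ) (R : Matrix (ι0 × ιz) (ι0 × ιz) ℂ) (b b' : ιz) :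
    auxL R X b b' = ∑ a, ∑ c, X a c * R (c, b) (a, b') := aux_entry X R b b'

lemma auxL_one (X : Matrix ι0 ι0 ℂ) :
    auxL (1 : Matrix (ι0 × ιz) (ι0 × ιz) ℂ) X = X.trace • (1 : Matrix ιz ιz ℂ) := by
  ext b b'
  rw [auxL_entry]
  by_cases h : b = b'
  · subst h
    simp [Matrix.one_apply, Matrix.trace]
  · simp [Matrix.one_apply, h]

lemma auxL_herm {X : Matrix ι0 ι0 ℂ} {R : Matrix (ι0 × ιz) (ι0 × ιz) ℂ}
    (hX : X.IsHermitian) (hR : R.IsHermitian) : (auxL R X).IsHermitian := by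
  ext b b'
  rw [Matrix.conjTranspose_apply, auxL_entry, auxL_entry, star_sum, Finset.sum_comm]
  simp only [star_sum, star_mul']
  rw [Finset.sum_comm]
  rw [Finset.sum_comm]
  refine Finset.sum_congr rfl fun a _ => Finset.sum_congr rfl fun c _ => ?_
  rw [hX.apply, hR.apply]

open scoped Matrix.Norms.L2Operator MatrixOrder in
lemma auxL_psd {X : Matrix ι0 ι0 ℂ} {R : Matrix (ι0 × ιz) (ι0 × ιz) ℂ}
    (hX : X.PosSemidef) (hR : R.PosSemidef) : (auxL R X).PosSemidef := by
  obtain ⟨B, rfl⟩ : ∃ B : Matrix ι0 ι0 ℂ, X = Bᴴ * B := by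
    exact CStarAlgebra.nonneg_iff_eq_star_mul_self.1 (Matrix.nonneg_iff_posSemidef.2 hX)
  have h1 := hR.mul_mul_conjTranspose_same (B ⊗ₖ (1 : Matrix ιz ιz ℂ))
  have h2 : auxL R (Bᴴ * B) = ∑ a, ((B ⊗ₖ (1 : Matrix ιz ιz ℂ)) * R *
      (B ⊗ₖ (1 : Matrix ιz ιz ℂ))ᴴ).submatrix (fun b => (a, b)) (fun b => (a, b)) := by
    ext b b'
    rw [auxL_entry, Matrix.sum_apply]
    simp only [Matrix.submatrix_apply, Matrix.mul_apply, Fintype.sum_prod_type,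
      Matrix.conjTranspose_apply, Matrix.kroneckerMap_apply, Matrix.one_apply, mul_ite, ite_mul,
      mul_one, mul_zero, zero_mul, Finset.sum_ite_eq, Finset.mem_univ, if_true, star_zero,
      apply_ite star, Finset.sum_mul]
    have e1 : ∀ x y : ι0, ∑ i, star (B i x) * B i y * R (y, b) (x, b') =
        ∑ i, B i y * R (y, b) (x, b') * star (B i x) := fun x y =>
      Finset.sum_congr rfl fun i _ => by ring
    simp only [e1]
    have e2 : ∀ x : ι0, ∑ y, ∑ i, B i y * R (y, b) (x, b') * star (B i x) =
        ∑ i, ∑ y, B i y * R (y, b) (x, b') * star (B i x) := fun x => Finset.sum_comm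
    simp only [e2]
    exact Finset.sum_comm
  rw [h2]
  exact Matrix.posSemidef_sum _ fun a _ => h1.submatrix _

lemma aux_choi (F : Matrix ι0 ι0 ℂ →ₗ[ℝ] Matrix ιz ιz ℂ) (hF : ∀ X, (F X).IsHermitian) :
    ∃ R : Matrix (ι0 × ιz) (ι0 × ιz) ℂ, R.IsHermitian ∧
      ∀ X : Matrix ι0 ι0 ℂ, X.IsHermitian → auxL R X = F X := by
  let Fc : Matrix ι0 ι0 ℂ → Matrix ιz ιz ℂ := fun M =>
    F (realPart M : Matrix ι0 ι0 ℂ) + Complex.I • F (imaginaryPart M : Matrix ι0 ι0 ℂ)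
  have hadd : ∀ M N, Fc (M + N) = Fc M + Fc N := by
    intro M N
    simp only [Fc, map_add, AddSubgroup.coe_add, smul_add]
    abel
  have hr : ∀ (r : ℝ) M, Fc (r • M) = r • Fc M := by
    intro r M
    simp only [Fc, map_smul, selfAdjoint.val_smul, smul_add]
    rw [smul_comm]
  have hI : ∀ M, Fc (Complex.I • M) = Complex.I • Fc M := by
    intro M
    simp only [Fc, realPart_I_smul, imaginaryPart_I_smul, smul_add, smul_smul, Complex.I_mul_I,
      AddSubgroup.coe_neg, map_neg, neg_smul, one_smul]
    abel
  have hc : ∀ (c : ℂ) M, Fc (c • M) = c • Fc M := by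
    intro c M
    have h : ∀ {n : Type} (N : Matrix n n ℂ), c • N = c.re • N + c.im • (Complex.I • N) := by
      intro n N
      ext i j
      simp only [Matrix.smul_apply, Matrix.add_apply, smul_eq_mul, Complex.real_smul]
      conv_lhs => rw [← Complex.re_add_im c]
      ring
    rw [h M, h (Fc M), hadd, hr, hr, hI]
  let G : Matrix ι0 ι0 ℂ →ₗ[ℂ] Matrix ιz ιz ℂ := ⟨⟨Fc, hadd⟩, hc⟩
  have hstar : ∀ M, (G M)ᴴ = G Mᴴ := by
    intro M
    change (Fc M)ᴴ = Fc Mᴴ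
    have e1 : realPart Mᴴ = realPart M := by
      apply Subtype.ext
      simp [realPart_apply_coe, ← Matrix.star_eq_conjTranspose, add_comm]
    have e2 : imaginaryPart Mᴴ = - imaginaryPart M := by
      apply Subtype.ext
      simp [imaginaryPart_apply_coe, ← Matrix.star_eq_conjTranspose]
      rw [← smul_neg, ← smul_neg, neg_sub]
    simp only [Fc, e1, e2, Matrix.conjTranspose_add, Matrix.conjTranspose_smul, (hF _).eq,
      AddSubgroup.coe_neg, map_neg, smul_neg]
    simp
  have hG : ∀ X : Matrix ι0 ι0 ℂ, X.IsHermitian → G X = F X := by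
    intro X hX
    have hX' : IsSelfAdjoint X := hX
    change F _ + Complex.I • F _ = _
    rw [hX'.coe_realPart, hX'.imaginaryPart]
    simp
  refine ⟨Matrix.of fun p q => G (Matrix.single q.1 p.1 1) p.2 q.2, ?_, ?_⟩
  · ext ⟨a, b⟩ ⟨c, d⟩
    rw [Matrix.conjTranspose_apply, Matrix.of_apply, Matrix.of_apply,
      ← Matrix.conjTranspose_apply (G _), hstar]
    simp
  · intro X hX
    rw [← hG X hX]
    ext b b'
    rw [auxL_entry]
    conv_rhs => rw [Matrix.matrix_eq_sum_single X]
    simp only [map_sum, Matrix.sum_apply]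
    refine Finset.sum_congr rfl fun a _ => Finset.sum_congr rfl fun c _ => ?_
    have : Matrix.single a c (X a c) = X a c • Matrix.single a c (1 : ℂ) := by
      simp
    rw [this, map_smul]
    rfl

/-- direction condition -/
def auxV (Δ : Submodule ℝ (Matrix ι0 ι0 ℂ)) (Δz : Submodule ℝ (Matrix ιz ιz ℂ))
    (H : Matrix (ι0 × ιz) (ι0 × ιz) ℂ) : Prop :=
  H.IsHermitian ∧ ∀ X ∈ Δ ⊔ Submodule.span ℝ {(1 : Matrix ι0 ι0 ℂ)}, auxL H X ∈ Δz

lemma aux_herm (Δ : Submodule ℝ (Matrix ι0 ι0 ℂ)) (h : ∀ T ∈ Δ, T.IsHermitian ∧ T.trace = 0)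
    (X : Matrix ι0 ι0 ℂ) (hX : X ∈ Δ ⊔ Submodule.span ℝ {(1 : Matrix ι0 ι0 ℂ)}) :
    X.IsHermitian := by
  obtain ⟨u, hu, v, hv, rfl⟩ := Submodule.mem_sup.1 hX
  obtain ⟨c, rfl⟩ := Submodule.mem_span_singleton.1 hv
  refine (h u hu).1.add ?_
  rw [Matrix.IsHermitian, Matrix.conjTranspose_smul]
  simp

lemma aux_inter [Nonempty ι0] (Δx Δy : Submodule ℝ (Matrix ι0 ι0 ℂ))
    (hΔx : ∀ T ∈ Δx, T.IsHermitian ∧ T.trace = 0)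
    (hΔy : ∀ T ∈ Δy, T.IsHermitian ∧ T.trace = 0) (Y : Matrix ι0 ι0 ℂ)
    (h1 : Y ∈ Δx ⊔ Submodule.span ℝ {(1 : Matrix ι0 ι0 ℂ)})
    (h2 : Y ∈ Δy ⊔ Submodule.span ℝ {(1 : Matrix ι0 ι0 ℂ)}) :
    Y ∈ (Δx ⊓ Δy) ⊔ Submodule.span ℝ {(1 : Matrix ι0 ι0 ℂ)} := by
  obtain ⟨u, hu, v, hv, huv⟩ := Submodule.mem_sup.1 h1
  obtain ⟨c, rfl⟩ := Submodule.mem_span_singleton.1 hv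
  obtain ⟨u', hu', v', hv', huv'⟩ := Submodule.mem_sup.1 h2
  obtain ⟨d, rfl⟩ := Submodule.mem_span_singleton.1 hv'
  have e := congrArg Matrix.trace (huv.trans huv'.symm)
  rw [Matrix.trace_add, Matrix.trace_add, Matrix.trace_smul, Matrix.trace_smul, (hΔx u hu).2,
    (hΔy u' hu').2, zero_add, zero_add, Matrix.trace_one, Complex.real_smul,
    Complex.real_smul] at e
  have hn : (Fintype.card ι0 : ℂ) ≠ 0 := Nat.cast_ne_zero.2 Fintype.card_ne_zero
  have hcd : c = d := Complex.ofReal_injective (mul_right_cancel₀ hn e)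
  subst hcd
  have huu : u = u' := add_right_cancel (huv.trans huv'.symm)
  subst huu
  rw [← huv]
  exact Submodule.add_mem_sup (Submodule.mem_inf.2 ⟨hu, hu'⟩) hv

lemma aux_split [Nonempty ι0] (Δx Δy : Submodule ℝ (Matrix ι0 ι0 ℂ))
    (Δz : Submodule ℝ (Matrix ιz ιz ℂ))
    (hΔx : ∀ T ∈ Δx, T.IsHermitian ∧ T.trace = 0)
    (hΔy : ∀ T ∈ Δy, T.IsHermitian ∧ T.trace = 0)
    (H : Matrix (ι0 × ιz) (ι0 × ιz) ℂ) (hH : auxV (Δx ⊓ Δy) Δz H) :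
    ∃ H1 H2, auxV Δx Δz H1 ∧ auxV Δy Δz H2 ∧ H = H1 + H2 := by
  obtain ⟨P, hP1, hP2, hP3⟩ := aux_proj (Δx ⊔ Submodule.span ℝ {(1 : Matrix ι0 ι0 ℂ)})
    (Δy ⊔ Submodule.span ℝ {(1 : Matrix ι0 ι0 ℂ)})
  have hF : ∀ X, (((auxL H).comp P) X).IsHermitian := by
    intro X
    rw [LinearMap.comp_apply]
    exact auxL_herm (aux_herm Δx hΔx _ (hP1 X)) hH.1
  obtain ⟨R, hR, hRL⟩ := aux_choi _ hF
  refine ⟨H - R, R, ⟨hH.1.sub hR, fun X hX => ?_⟩, ⟨hR, fun X hX => ?_⟩,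
    (sub_add_cancel H R).symm⟩
  · rw [map_sub, LinearMap.sub_apply, hRL X (aux_herm Δx hΔx X hX), LinearMap.comp_apply, hP2 X hX,
      sub_self]
    exact zero_mem _
  · rw [hRL X (aux_herm Δy hΔy X hX), LinearMap.comp_apply]
    apply hH.2
    obtain ⟨h1, h2⟩ := Submodule.mem_inf.1 (hP3 X hX)
    exact aux_inter Δx Δy hΔx hΔy _ h1 h2

/-- centre -/
def auxR0 (lam lamz : ℝ) : Matrix (ι0 × ιz) (ι0 × ιz) ℂ :=
  (lamz / (lam * Fintype.card ι0)) • (1 : Matrix (ι0 × ιz) (ι0 × ιz) ℂ)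

lemma auxR0_L [Nonempty ι0] (lam lamz : ℝ) (hlam : 0 < lam) (X T : Matrix ι0 ι0 ℂ)
    (hT : T.trace = 0) (hX : X - lam • 1 = T) :
    auxL (auxR0 (ιz := ιz) lam lamz) X = lamz • (1 : Matrix ιz ιz ℂ) := by
  have : X = lam • 1 + T := by rw [← hX]; abel
  rw [auxR0, map_smul, LinearMap.smul_apply, auxL_one, this, Matrix.trace_add, hT,
    Matrix.trace_smul, Matrix.trace_one, add_zero]
  have hn : (Fintype.card ι0 : ℂ) ≠ 0 := by exact_mod_cast Fintype.card_ne_zero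
  have hl : (lam : ℂ) ≠ 0 := by exact_mod_cast hlam.ne'
  ext i j
  simp only [Matrix.smul_apply, smul_eq_mul, Complex.real_smul]
  push_cast
  field_simp

lemma aux_mem [Nonempty ι0] (lam lamz : ℝ) (hlam : 0 < lam)
    (Δ : Submodule ℝ (Matrix ι0 ι0 ℂ)) (Δz : Submodule ℝ (Matrix ιz ιz ℂ))
    (hΔ : ∀ T ∈ Δ, T.IsHermitian ∧ T.trace = 0)
    (H : Matrix (ι0 × ιz) (ι0 × ιz) ℂ) (hH : auxV Δ Δz H)
    (hp : (auxR0 lam lamz + H).PosSemidef) :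
    auxR0 lam lamz + H ∈ detArrow (detSet lam (Δ : Set _)) (detSet lamz (Δz : Set _)) := by
  refine ⟨hp, fun X hX => ⟨auxL_psd hX.1 hp, ?_⟩⟩
  rw [← auxL_apply, map_add, LinearMap.add_apply,
    auxR0_L lam lamz hlam X _ (hΔ _ hX.2).2 rfl, add_sub_cancel_left]
  apply hH.2
  have : X = (X - lam • 1) + lam • 1 := by abel
  rw [this]
  exact Submodule.add_mem_sup hX.2 (Submodule.mem_span_singleton.2 ⟨lam, rfl⟩)

lemma aux_dir [Nonempty ι0] (lam lamz : ℝ) (hlam : 0 < lam)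
    (Δ : Submodule ℝ (Matrix ι0 ι0 ℂ)) (Δz : Submodule ℝ (Matrix ιz ιz ℂ))
    (hΔ : ∀ T ∈ Δ, T.IsHermitian ∧ T.trace = 0)
    (R : Matrix (ι0 × ιz) (ι0 × ιz) ℂ)
    (hR : R ∈ detArrow (detSet lam (Δ : Set _)) (detSet lamz (Δz : Set _))) :
    auxV Δ Δz (R - auxR0 lam lamz) := by
  have key : ∀ X ∈ detSet lam (Δ : Set (Matrix ι0 ι0 ℂ)), auxL (R - auxR0 lam lamz) X ∈ Δz := by
    intro X hX
    rw [map_sub, LinearMap.sub_apply, auxR0_L lam lamz hlam X _ (hΔ _ hX.2).2 rfl]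
    exact (hR.2 X hX).2
  have h1 : auxL (R - auxR0 lam lamz) (1 : Matrix ι0 ι0 ℂ) ∈ Δz := by
    have := key (lam • 1) ⟨aux_psd_smul Matrix.PosSemidef.one hlam.le, by simp⟩
    rw [map_smul] at this
    exact (Submodule.smul_mem_iff _ hlam.ne').1 this
  refine ⟨hR.1.1.sub ?_, fun X hX => ?_⟩
  · rw [auxR0, Matrix.IsHermitian, Matrix.conjTranspose_smul]
    simp
  · obtain ⟨u, hu, v, hv, rfl⟩ := Submodule.mem_sup.1 hX
    obtain ⟨c, rfl⟩ := Submodule.mem_span_singleton.1 hv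
    rw [map_add, map_smul]
    refine add_mem ?_ (Submodule.smul_mem _ _ h1)
    obtain ⟨e, he, hp⟩ := aux_pert u (hΔ u hu).1 lam hlam
    have := key _ ⟨hp, by simpa using Submodule.smul_mem _ e hu⟩
    rw [map_add, map_smul, map_smul] at this
    have := (Submodule.add_mem_iff_right _ (Submodule.smul_mem _ lam h1)).1 this
    exact (Submodule.smul_mem_iff _ he.ne').1 this

lemma aux_span_s17 [Nonempty ι0] (lam lamz : ℝ) (hlam : 0 < lam) (hlamz : 0 < lamz)
    (Δ : Submodule ℝ (Matrix ι0 ι0 ℂ)) (Δz : Submodule ℝ (Matrix ιz ιz ℂ))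
    (hΔ : ∀ T ∈ Δ, T.IsHermitian ∧ T.trace = 0)
    (H : Matrix (ι0 × ιz) (ι0 × ιz) ℂ) (hH : auxV Δ Δz H) :
    ∃ e : ℝ, 0 < e ∧
      auxR0 lam lamz + e • H ∈ detArrow (detSet lam (Δ : Set _)) (detSet lamz (Δz : Set _)) := by
  have hc : 0 < lamz / (lam * Fintype.card ι0) := by
    have : 0 < Fintype.card ι0 := Fintype.card_pos
    positivity
  obtain ⟨e, he, hp⟩ := aux_pert H hH.1 _ hc
  refine ⟨e, he, aux_mem lam lamz hlam Δ Δz hΔ _ ⟨hp.1 |> fun _ => ?_, fun X hX => ?_⟩ hp⟩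
  · rw [Matrix.IsHermitian, Matrix.conjTranspose_smul, hH.1.eq]
    simp
  · rw [map_smul, LinearMap.smul_apply]
    exact Submodule.smul_mem _ _ (hH.2 X hX)

end

/-- `D((x∩y)→z)` equals the set of PSD operators on `H_0⊗H_z` lying in the
affine span of `D(x→z) ∪ D(y→z)`, where `x∩y` is the type datum `(λ, Δ_x ∩ Δ_y)`. -/
theorem stmt_17 {ι0 ιz : Type} [Fintype ι0] [DecidableEq ι0] [Nonempty ι0]
    [Fintype ιz] [DecidableEq ιz] [Nonempty ιz]
    (lam lamz : ℝ) (hlam : 0 < lam) (hlamz : 0 < lamz)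
    (Δx Δy : Submodule ℝ (Matrix ι0 ι0 ℂ)) (Δz : Submodule ℝ (Matrix ιz ιz ℂ))
    (hΔx : ∀ T ∈ Δx, T.IsHermitian ∧ T.trace = 0)
    (hΔy : ∀ T ∈ Δy, T.IsHermitian ∧ T.trace = 0)
    (hΔz : ∀ T ∈ Δz, T.IsHermitian ∧ T.trace = 0) :
    detArrow (detSet lam ((Δx ⊓ Δy : Submodule ℝ (Matrix ι0 ι0 ℂ)) : Set _))
        (detSet lamz (Δz : Set (Matrix ιz ιz ℂ))) =
      {R : Matrix (ι0 × ιz) (ι0 × ιz) ℂ | R.PosSemidef ∧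
        R ∈ affineSpan ℝ
          (detArrow (detSet lam (Δx : Set _)) (detSet lamz (Δz : Set _)) ∪
           detArrow (detSet lam (Δy : Set _)) (detSet lamz (Δz : Set _)))} := by
  have hΔ : ∀ T ∈ Δx ⊓ Δy, T.IsHermitian ∧ T.trace = 0 := fun T hT => hΔx T hT.1
  ext R
  constructor
  · intro hR
    refine ⟨hR.1, ?_⟩
    obtain ⟨H1, H2, h1, h2, h12⟩ := aux_split Δx Δy Δz hΔx hΔy _
      (aux_dir lam lamz hlam _ Δz hΔ R hR)
    obtain ⟨e1, he1, m1⟩ := aux_span_s17 lam lamz hlam hlamz Δx Δz hΔx H1 h1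
    obtain ⟨e2, he2, m2⟩ := aux_span_s17 lam lamz hlam hlamz Δy Δz hΔy H2 h2
    have h0 : auxV Δx Δz (0 : Matrix (ι0 × ιz) (ι0 × ιz) ℂ) :=
      ⟨Matrix.isHermitian_zero, fun X _ => by simp⟩
    obtain ⟨e0, he0, m0⟩ := aux_span_s17 lam lamz hlam hlamz Δx Δz hΔx 0 h0
    rw [smul_zero, add_zero] at m0
    have s0 := subset_affineSpan ℝ _ (Set.mem_union_left
      (detArrow (detSet lam (Δy : Set _)) (detSet lamz (Δz : Set _))) m0)
    have s1 := subset_affineSpan ℝ _ (Set.mem_union_left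
      (detArrow (detSet lam (Δy : Set _)) (detSet lamz (Δz : Set _))) m1)
    have s2 := subset_affineSpan ℝ _ (Set.mem_union_right
      (detArrow (detSet lam (Δx : Set _)) (detSet lamz (Δz : Set _))) m2)
    have s3 := AffineSubspace.smul_vsub_vadd_mem _ e1⁻¹ s1 s0 s0
    have s4 := AffineSubspace.smul_vsub_vadd_mem _ e2⁻¹ s2 s0 s3
    convert s4 using 1
    simp only [vsub_eq_sub, vadd_eq_add, add_sub_cancel_left, smul_smul,
      inv_mul_cancel₀ he1.ne', inv_mul_cancel₀ he2.ne', one_smul]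
    rw [← sub_add_cancel R (auxR0 lam lamz), h12]
    abel
  · rintro ⟨hp, hR⟩
    refine ⟨hp, fun X hX => ⟨auxL_psd hX.1 hp, ?_⟩⟩
    rw [← auxL_apply]
    refine affineSpan_induction (p := fun R => auxL R X - lamz • (1 : Matrix ιz ιz ℂ) ∈ Δz) hR ?_ ?_
    · rintro S (hS | hS)
      · exact (hS.2 X ⟨hX.1, hX.2.1⟩).2
      · exact (hS.2 X ⟨hX.1, hX.2.2⟩).2
    · intro c u v w hu hv hw
      have := add_mem (Submodule.smul_mem _ c (sub_mem hu hv)) hw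
      convert this using 1
      simp only [vsub_eq_sub, vadd_eq_add, map_add, map_sub, map_smul, LinearMap.add_apply,
        LinearMap.sub_apply, LinearMap.smul_apply, sub_sub_sub_cancel_right]
      abel

end
end
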